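/- Let λ be a partition with at most n rows and let T ∈ SVT^n(λ) be Yamanouchi with wt(T) = μ (then μ is necessarily a partition). Let SVT^n(T) denote the closure of {T} under all operators e_i and f_i (1 ≤ i < n). Then there is a crystal isomorphism SVT^n(T) → SSYT^n(μ): a bijection φ (with φ(0) = 0) satisfying wt(φ(S)) = wt(S), φ(e_i S) = e_i φ(S), and φ(f_i S) = f_i φ(S) for all i and all S ∈ SVT^n(T). -/

import Mathlib

open scoped Classical

noncomputable section

namespace SVTCrystal

/-- A filling assigns to each (row, column) position (0-indexed) a finite set of entries. -/
abbrev Filling : Type := ℕ → ℕ → Finset ℕ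

/-- `lam` is a partition shape with at most `n` rows. -/
def IsPartitionShape (n : ℕ) (lam : ℕ → ℕ) : Prop :=
  (∀ r, lam (r + 1) ≤ lam r) ∧ (∀ r, n ≤ r → lam r = 0)

/-- Semistandard set-valued tableau of shape `lam` with entries in `{1,…,n}`. -/
structure IsSVT (n : ℕ) (lam : ℕ → ℕ) (t : Filling) : Prop where
  boxNonempty : ∀ r c, c < lam r → (t r c).Nonempty
  emptyOutside : ∀ r c, ¬ c < lam r → t r c = ∅
  entryBounds : ∀ r c a, a ∈ t r c → 1 ≤ a ∧ a ≤ n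
  rowWeak : ∀ r c a b, a ∈ t r c → b ∈ t r (c + 1) → a ≤ b
  colStrict : ∀ r c a b, a ∈ t r c → b ∈ t (r + 1) c → a < b

/-- Semistandard Young tableau: a set-valued tableau all of whose boxes are singletons. -/
def IsSSYT (n : ℕ) (lam : ℕ → ℕ) (t : Filling) : Prop :=
  IsSVT n lam t ∧ ∀ r c, c < lam r → (t r c).card = 1

/-- The weight: `wt n lam t j` is the number of boxes of `t` containing the entry `j`. -/
def wt (n : ℕ) (lam : ℕ → ℕ) (t : Filling) (j : ℕ) : ℕ :=
  ((Finset.range n ×ˢ Finset.range (lam 0)).filter (fun p => j ∈ t p.1 p.2)).card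

/-- The excess: total number of extra entries. -/
def excess (n : ℕ) (lam : ℕ → ℕ) (t : Filling) : ℕ :=
  ∑ p ∈ Finset.range n ×ˢ Finset.range (lam 0), ((t p.1 p.2).card - 1)

/-- Column `c` contains the entry `a`. -/
def colHas (n : ℕ) (t : Filling) (a c : ℕ) : Prop := ∃ r, r < n ∧ a ∈ t r c

/-- The sign of column `c` for the `i`-signature rule: `+` (true) if the column contains `i`
but not `i+1`, `-` (false) if it contains `i+1` but not `i`. -/
def colSign (n : ℕ) (t : Filling) (i c : ℕ) : Option Bool :=
  if colHas n t i c ∧ ¬ colHas n t (i + 1) c then some true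
  else if colHas n t (i + 1) c ∧ ¬ colHas n t i c then some false
  else none

/-- The number of `-` (false) signs left uncanceled after scanning the word left-to-right,
iteratively canceling `-+` pairs. -/
def mctr (w : List Bool) : ℕ := w.foldl (fun cnt b => if b then cnt - 1 else cnt + 1) 0

/-- The number of `+` (true) signs left uncanceled, scanning right-to-left. -/
def pctr (w : List Bool) : ℕ := w.foldr (fun b cnt => if b then cnt + 1 else cnt - 1) 0

/-- The word of column signs of the columns before column `c`. -/
def colWordBefore (n : ℕ) (t : Filling) (i c : ℕ) : List Bool :=
  (List.range c).filterMap (colSign n t i)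

/-- The word of column signs of the columns after column `c` (among columns `< ncols`). -/
def colWordAfter (n ncols : ℕ) (t : Filling) (i c : ℕ) : List Bool :=
  ((List.range ncols).drop (c + 1)).filterMap (colSign n t i)

/-- Column `c` carries an uncanceled `+` for the `i`-signature rule. -/
def PlusCol (n ncols : ℕ) (t : Filling) (i c : ℕ) : Prop :=
  c < ncols ∧ colSign n t i c = some true ∧ mctr (colWordBefore n t i c) = 0

/-- Column `c` carries an uncanceled `-` for the `i`-signature rule. -/
def MinusCol (n ncols : ℕ) (t : Filling) (i c : ℕ) : Prop :=
  c < ncols ∧ colSign n t i c = some false ∧ pctr (colWordAfter n ncols t i c) = 0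

/-- Column `c` is the rightmost uncanceled `+`. -/
def fBoxCol (n ncols : ℕ) (t : Filling) (i c : ℕ) : Prop :=
  PlusCol n ncols t i c ∧ ∀ c', PlusCol n ncols t i c' → c' ≤ c

/-- Column `c` is the leftmost uncanceled `-`. -/
def eBoxCol (n ncols : ℕ) (t : Filling) (i c : ℕ) : Prop :=
  MinusCol n ncols t i c ∧ ∀ c', MinusCol n ncols t i c' → c ≤ c'

/-- Replace the content of the box in row `r`, column `c` by `A`. -/
def updateBox (t : Filling) (r c : ℕ) (A : Finset ℕ) : Filling :=
  fun r' c' => if r' = r ∧ c' = c then A else t r' c'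

/-- The set-valued crystal operator `f_i` (signature rule). -/
def fRaw (n : ℕ) (lam : ℕ → ℕ) (i : ℕ) (t : Filling) : Option Filling :=
  if h : ∃ c, fBoxCol n (lam 0) t i c then
    let c := Classical.choose h
    if hr : ∃ r, r < n ∧ i ∈ t r c then
      let r := Classical.choose hr
      if i ∈ t r (c + 1) then
        some (updateBox (updateBox t r (c + 1) ((t r (c + 1)).erase i)) r c
          (insert (i + 1) (t r c)))
      else some (updateBox t r c (insert (i + 1) ((t r c).erase i)))
    else none
  else none

/-- The set-valued crystal operator `e_i` (signature rule). -/
def eRaw (n : ℕ) (lam : ℕ → ℕ) (i : ℕ) (t : Filling) : Option Filling :=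
  if h : ∃ c, eBoxCol n (lam 0) t i c then
    let c := Classical.choose h
    if hr : ∃ r, r < n ∧ (i + 1) ∈ t r c then
      let r := Classical.choose hr
      if 0 < c ∧ (i + 1) ∈ t r (c - 1) then
        some (updateBox (updateBox t r (c - 1) ((t r (c - 1)).erase (i + 1))) r c
          (insert i (t r c)))
      else some (updateBox t r c (insert i ((t r c).erase (i + 1))))
    else none
  else none

/-- Iterate a partially-defined operator. -/
def iterOpt (g : Filling → Option Filling) : ℕ → Filling → Option Filling
  | 0, t => some t
  | m + 1, t => (iterOpt g m t).bind g

/-- Highest weight (Yamanouchi) elements. -/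
def IsYamanouchi (n : ℕ) (lam : ℕ → ℕ) (t : Filling) : Prop :=
  ∀ i, 1 ≤ i → i < n → eRaw n lam i t = none

/-- Closure of `t0` under the crystal operators `e_i`, `f_i` for `1 ≤ i < n`. -/
inductive Reach (n : ℕ) (lam : ℕ → ℕ) (t0 : Filling) : Filling → Prop
  | base : Reach n lam t0 t0
  | stepF : ∀ {t t' : Filling} (i : ℕ), 1 ≤ i → i < n → Reach n lam t0 t →
      fRaw n lam i t = some t' → Reach n lam t0 t'
  | stepE : ∀ {t t' : Filling} (i : ℕ), 1 ≤ i → i < n → Reach n lam t0 t →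
      eRaw n lam i t = some t' → Reach n lam t0 t'

/-- The one-row partition `(s)`. -/
def rowShape (s : ℕ) : ℕ → ℕ := fun r => if r = 0 then s else 0

/-- The one-column partition `(1^k)`. -/
def colShape (k : ℕ) : ℕ → ℕ := fun r => if r < k then 1 else 0

/-- The hook partition `(s, 1^e)`. -/
def hookShape (s e : ℕ) : ℕ → ℕ := fun r => if r = 0 then s else if r ≤ e then 1 else 0

/-! ### K-theory crystal operators (for single rows and single columns) -/

/-- Some box of the tableau contains the entry `a`. -/
def containsEntry (n : ℕ) (lam : ℕ → ℕ) (t : Filling) (a : ℕ) : Prop :=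
  ∃ r c, r < n ∧ c < lam r ∧ a ∈ t r c

/-- `p` is the rightmost box of `t` containing `i`. -/
def KBoxF (n : ℕ) (lam : ℕ → ℕ) (t : Filling) (i : ℕ) (p : ℕ × ℕ) : Prop :=
  p.1 < n ∧ p.2 < lam p.1 ∧ i ∈ t p.1 p.2 ∧
    ∀ q : ℕ × ℕ, q.1 < n → q.2 < lam q.1 → i ∈ t q.1 q.2 → q.2 ≤ p.2

/-- The K-crystal operator `f_i^K`: if `i` occurs in `t` and `i+1` does not, add `i+1` to
the rightmost box containing `i`; otherwise `0`. -/
def fK (n : ℕ) (lam : ℕ → ℕ) (i : ℕ) (t : Filling) : Option Filling :=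
  if h : (∃ p : ℕ × ℕ, KBoxF n lam t i p) ∧ ¬ containsEntry n lam t (i + 1) then
    let p := Classical.choose h.1
    some (updateBox t p.1 p.2 (insert (i + 1) (t p.1 p.2)))
  else none

/-- The K-crystal operator `e_i^K`: delete `i+1` from the box containing both `i` and `i+1`,
if such a box exists; otherwise `0`. -/
def eK (n : ℕ) (lam : ℕ → ℕ) (i : ℕ) (t : Filling) : Option Filling :=
  if h : ∃ p : ℕ × ℕ, p.1 < n ∧ p.2 < lam p.1 ∧ i ∈ t p.1 p.2 ∧ (i + 1) ∈ t p.1 p.2 then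
    let p := Classical.choose h
    some (updateBox t p.1 p.2 ((t p.1 p.2).erase (i + 1)))
  else none

/-- `t'` is the result of applying `g` to `t` as many times as possible. -/
def MaxApply (g : Filling → Option Filling) (t t' : Filling) : Prop :=
  (∃ m, iterOpt g m t = some t') ∧ g t' = none

/-- One Demazure step: apply `e_i` as many times as possible, then `e_i^K` as many times
as possible (here `eKop i` is the `i`-th K-operator). -/
def DemStep (n : ℕ) (lam : ℕ → ℕ) (eKop : ℕ → Filling → Option Filling) (i : ℕ)
    (t t' : Filling) : Prop :=
  ∃ t1, MaxApply (eRaw n lam i) t t1 ∧ MaxApply (eKop i) t1 t'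

/-- `DemReach n lam eKop [i₁,…,iℓ] t u` holds when
`u = (e_{iℓ}^K)^max e_{iℓ}^max ⋯ (e_{i₁}^K)^max e_{i₁}^max t`. -/
def DemReach (n : ℕ) (lam : ℕ → ℕ) (eKop : ℕ → Filling → Option Filling) :
    List ℕ → Filling → Filling → Prop
  | [], t, u => t = u
  | i :: rest, t, u => ∃ t2, DemStep n lam eKop i t t2 ∧ DemReach n lam eKop rest t2 u

/-- The minimal highest weight tableau `u_λ`, whose row `r` boxes are all `{r+1}`. -/
def uTab (lam : ℕ → ℕ) : Filling := fun r c => if c < lam r then {r + 1} else ∅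

/-- The K-Demazure crystal associated with a word `[i₁,…,iℓ]`. -/
def KDem (n : ℕ) (lam : ℕ → ℕ) (eKop : ℕ → Filling → Option Filling) (word : List ℕ) :
    Set Filling :=
  {t | IsSVT n lam t ∧ DemReach n lam eKop word t (uTab lam)}

/-! ### Permutations and reduced words -/

/-- The permutation `s_{i₁} ⋯ s_{iℓ}` of a word `[i₁,…,iℓ]`, where `s_i` swaps `i`, `i+1`. -/
def wordPerm (word : List ℕ) : Equiv.Perm ℕ :=
  (word.map fun i => Equiv.swap i (i + 1)).prod

/-- `word` is a reduced word for `w` in the Coxeter generators `s_1, …, s_{n-1}`. -/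
def IsReducedWord (n : ℕ) (w : Equiv.Perm ℕ) (word : List ℕ) : Prop :=
  (∀ i ∈ word, 1 ≤ i ∧ i < n) ∧ wordPerm word = w ∧
    ∀ word' : List ℕ, (∀ i ∈ word', 1 ≤ i ∧ i < n) → wordPerm word' = w →
      word.length ≤ word'.length

/-- The Coxeter length of a permutation of `{1,…,n}`. -/
def permLength (n : ℕ) (σ : Equiv.Perm ℕ) : ℕ :=
  sInf {l | ∃ word : List ℕ, (∀ i ∈ word, 1 ≤ i ∧ i < n) ∧ wordPerm word = σ ∧
    word.length = l}

/-- The parabolic subgroup generated by `s_2, …, s_{n-1}`. -/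
def parabolic (n : ℕ) : Subgroup (Equiv.Perm ℕ) :=
  Subgroup.closure {σ | ∃ i, 2 ≤ i ∧ i < n ∧ σ = Equiv.swap i (i + 1)}

/-! ### Polynomials -/

/-- Polynomials in `x₁, x₂, …` over `ℤ[β]`; the variable `β` is `Polynomial.X`. -/
abbrev KPoly : Type := MvPolynomial ℕ (Polynomial ℤ)

/-- The scalar `β`. -/
def betaP : KPoly := MvPolynomial.C Polynomial.X

/-- The monomial `x^{wt(T)} = x₁^{wt₁} ⋯ xₙ^{wtₙ}`. -/
def xwt (n : ℕ) (lam : ℕ → ℕ) (t : Filling) : KPoly :=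
  ∏ j ∈ Finset.Icc 1 n, (MvPolynomial.X j : KPoly) ^ wt n lam t j

/-- The β-character `∑_{T ∈ S} β^{excess T} x^{wt T}` of a set of tableaux. -/
def charSet (n : ℕ) (lam : ℕ → ℕ) (S : Set Filling) : KPoly :=
  ∑ᶠ t ∈ S, betaP ^ excess n lam t * xwt n lam t

/-- The symmetric Grothendieck polynomial `𝔊_λ(x₁,…,xₙ; β)`. -/
def Groth (n : ℕ) (lam : ℕ → ℕ) : KPoly :=
  charSet n lam {t | IsSVT n lam t}

/-- The Schur polynomial `s_μ(x₁,…,xₙ)`. -/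
def SchurP (n : ℕ) (mu : ℕ → ℕ) : KPoly :=
  ∑ᶠ t ∈ {t : Filling | IsSSYT n mu t}, xwt n mu t

/-- The numerator defining the Demazure–Lascoux operator `ϖ_i`. -/
def DLnum (i : ℕ) (f : KPoly) : KPoly :=
  (MvPolynomial.X i + betaP * MvPolynomial.X i * MvPolynomial.X (i + 1)) * f -
    (MvPolynomial.X (i + 1) + betaP * MvPolynomial.X i * MvPolynomial.X (i + 1)) *
      (MvPolynomial.rename (Equiv.swap i (i + 1)) f)

/-- `DL` implements the Demazure–Lascoux operators `ϖ_i` for `1 ≤ i < n`: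
`(x_i - x_{i+1}) · ϖ_i f` equals the defining numerator. -/
def IsDLOp (n : ℕ) (DL : ℕ → KPoly → KPoly) : Prop :=
  ∀ i, 1 ≤ i → i < n → ∀ f : KPoly,
    (MvPolynomial.X i - MvPolynomial.X (i + 1)) * DL i f = DLnum i f

/-- `applyDL DL [i₁,…,iℓ] f = ϖ_{i₁} ϖ_{i₂} ⋯ ϖ_{iℓ} f`. -/
def applyDL (DL : ℕ → KPoly → KPoly) : List ℕ → KPoly → KPoly
  | [], f => f
  | i :: rest, f => DL i (applyDL DL rest f)

/-! ### Crystal operators on words -/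

/-- The number of uncanceled `+` signs in the `i`-signature of a word. -/
def wordPhi (i : ℕ) : List ℕ → ℕ
  | [] => 0
  | a :: w => if a = i then wordPhi i w + 1 else if a = i + 1 then wordPhi i w - 1 else wordPhi i w

/-- The number of uncanceled `-` signs in the `i`-signature of a word. -/
def wordEps (i : ℕ) : List ℕ → ℕ
  | [] => 0
  | a :: w => if a = i + 1 ∧ wordPhi i w = 0 then wordEps i w + 1 else wordEps i w

/-- `WordStep i w w'` holds when `w' = f_i w`, equivalently `w = e_i w'`. -/
def WordStep (i : ℕ) (w w' : List ℕ) : Prop :=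
  ∃ u v, w = u ++ i :: v ∧ w' = u ++ (i + 1) :: v ∧ wordEps i u = 0 ∧ wordPhi i v = 0

theorem word_append (i : ℕ) (u v : List ℕ) :
    wordPhi i (u ++ v) = wordPhi i u + (wordPhi i v - wordEps i u) ∧
      wordEps i (u ++ v) = wordEps i v + (wordEps i u - wordPhi i v) := by
  induction u with
  | nil => simp [wordPhi, wordEps]
  | cons a u ih =>
    obtain ⟨h1, h2⟩ := ih
    simp only [List.cons_append, wordPhi, wordEps, h1, h2]
    split_ifs <;> omega

theorem wordPhi_add_count (i : ℕ) (w : List ℕ) :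
    wordPhi i w + w.count (i + 1) = wordEps i w + w.count i := by
  induction w with
  | nil => simp [wordPhi, wordEps]
  | cons a w ih =>
    simp only [wordPhi, wordEps, List.count_cons, beq_iff_eq]
    split_ifs <;> omega

theorem wordEps_le (i q : ℕ) (w : List ℕ)
    (h : ∀ s₁ s₂, w = s₁ ++ (i + 1) :: s₂ → s₂.count (i + 1) + 1 ≤ s₂.count i + q) :
    wordEps i w ≤ q := by
  induction w with
  | nil => simp [wordEps]
  | cons a w ih =>
    have ih' := ih fun s₁ s₂ hs => h (a :: s₁) s₂ (by simp [hs])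
    have hc := wordPhi_add_count i w
    simp only [wordEps]
    split_ifs with ha
    · have := h [] w (by simp [ha.1])
      omega
    · exact ih'

theorem wordPhi_le (i q : ℕ) (w : List ℕ)
    (h : ∀ s₁ s₂, w = s₁ ++ i :: s₂ → s₁.count i + 1 ≤ s₁.count (i + 1) + q) :
    wordPhi i w ≤ q := by
  induction w using List.reverseRecOn with
  | nil => simp [wordPhi]
  | append_singleton w a ih =>
    have ih' := ih fun s₁ s₂ hs => h s₁ (s₂ ++ [a]) (by simp [hs])
    have hc := wordPhi_add_count i w
    rw [(word_append i w [a]).1]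
    by_cases ha : a = i
    · have := h w [] (by simp [ha])
      simp only [wordPhi, ha, if_true]
      omega
    · simp only [wordPhi, ha, if_false]
      split_ifs <;> omega

theorem wordEps_eq_zero_of_notMem {i : ℕ} {w : List ℕ} (h : i + 1 ∉ w) : wordEps i w = 0 :=
  Nat.le_zero.1 (wordEps_le i 0 w fun s₁ s₂ hs => absurd (by simp [hs]) h)

theorem wordPhi_eq_zero_of_notMem {i : ℕ} {w : List ℕ} (h : i ∉ w) : wordPhi i w = 0 :=
  Nat.le_zero.1 (wordPhi_le i 0 w fun s₁ s₂ hs => absurd (by simp [hs]) h)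

theorem wordStep_append {i : ℕ} {u v x : List ℕ} :
    WordStep i (u ++ v) x ↔
      (∃ v', x = u ++ v' ∧ WordStep i v v' ∧ wordEps i u < wordPhi i v) ∨
        ∃ u', x = u' ++ v ∧ WordStep i u u' ∧ wordPhi i v ≤ wordEps i u := by
  constructor
  · rintro ⟨a, b, hab, rfl, ha, hb⟩
    rw [List.append_eq_append_iff] at hab
    rcases hab with ⟨c, rfl, rfl⟩ | ⟨c, rfl, hc⟩
    · refine .inl ⟨c ++ (i + 1) :: b, by simp, ⟨c, b, rfl, rfl, ?_, hb⟩, ?_⟩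
      all_goals
        have h1 := (word_append i u c).2
        have h2 := (word_append i c (i :: b)).1
        simp only [wordPhi, if_true] at h2
        omega
    · cases c with
      | nil =>
        simp only [List.nil_append] at hc
        refine .inl ⟨(i + 1) :: b, by simp, ⟨[], b, by simp [hc], rfl, rfl, hb⟩, ?_⟩
        rw [← hc]
        simp [wordPhi, ha]
      | cons d c =>
        simp only [List.cons_append, List.cons.injEq] at hc
        obtain ⟨rfl, rfl⟩ := hc
        have h1 := (word_append i c v).1
        have h2 := (word_append i a (i :: c)).2
        simp only [wordEps] at h2
        rw [if_neg (by omega)] at h2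
        refine .inr ⟨a ++ (i + 1) :: c, by simp, ⟨a, c, rfl, rfl, ha, by omega⟩, by omega⟩
  · rintro (⟨_, rfl, ⟨a, b, rfl, rfl, ha, hb⟩, h⟩ | ⟨_, rfl, ⟨a, b, rfl, rfl, ha, hb⟩, h⟩)
    · refine ⟨u ++ a, b, by simp, by simp, ?_, hb⟩
      have h1 := (word_append i u a).2
      have h2 := (word_append i a (i :: b)).1
      simp only [wordPhi, if_true] at h2
      omega
    · refine ⟨a, b ++ v, by simp, by simp, ha, ?_⟩
      have h1 := (word_append i b v).1
      have h2 := (word_append i a (i :: b)).2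
      simp only [wordEps] at h2
      rw [if_neg (by omega)] at h2
      omega

theorem WordStep.phi_eps {i : ℕ} {w w' : List ℕ} (h : WordStep i w w') :
    wordPhi i w = wordPhi i w' + 1 ∧ wordEps i w' = wordEps i w + 1 := by
  obtain ⟨a, b, rfl, rfl, ha, hb⟩ := h
  have h1 := word_append i a (i :: b)
  have h2 := word_append i a ((i + 1) :: b)
  simp only [wordPhi, wordEps, ha, hb] at h1 h2
  simp at h1 h2
  omega

theorem wordStep_cons {i a : ℕ} {v x : List ℕ} :
    WordStep i (a :: v) x ↔
      (∃ v', x = a :: v' ∧ WordStep i v v' ∧ wordEps i [a] < wordPhi i v) ∨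
        (a = i ∧ x = (i + 1) :: v ∧ wordPhi i v = 0) := by
  have := wordStep_append (i := i) (u := [a]) (v := v) (x := x)
  simp only [List.singleton_append] at this
  rw [this]
  refine or_congr Iff.rfl ⟨?_, ?_⟩
  · rintro ⟨u', rfl, ⟨p, q, hpq, rfl, hp, hq⟩, h⟩
    rcases p with _ | ⟨p, ps⟩
    · simp only [List.nil_append, List.cons.injEq] at hpq
      obtain ⟨rfl, rfl⟩ := hpq
      simp [wordEps] at h
      simp [h]
    · simp at hpq
  · rintro ⟨rfl, rfl, h⟩
    exact ⟨[a + 1], by simp, ⟨[], [], rfl, rfl, rfl, rfl⟩, by omega⟩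

theorem WordStep.right_unique {i : ℕ} {w w₁ w₂ : List ℕ} (h₁ : WordStep i w w₁)
    (h₂ : WordStep i w w₂) : w₁ = w₂ := by
  induction w generalizing w₁ w₂ with
  | nil => obtain ⟨a, b, h, -⟩ := h₁; simp at h
  | cons a w ih =>
    rw [wordStep_cons] at h₁ h₂
    rcases h₁ with ⟨v, rfl, hv, h⟩ | ⟨rfl, rfl, h⟩ <;>
      rcases h₂ with ⟨v', rfl, hv', h'⟩ | ⟨h1, rfl, h'⟩
    · rw [ih hv hv']
    · omega
    · omega
    · rfl

theorem exists_wordStep {i : ℕ} {w : List ℕ} (h : 0 < wordPhi i w) : ∃ w', WordStep i w w' := by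
  induction w with
  | nil => simp [wordPhi] at h
  | cons a w ih =>
    simp only [wordStep_cons]
    by_cases hw : wordPhi i w = 0
    · simp only [wordPhi, hw] at h
      split_ifs at h with ha
      · exact ⟨_, .inr ⟨ha, rfl, hw⟩⟩
      all_goals omega
    · obtain ⟨w', hw'⟩ := ih (by omega)
      refine ⟨_, .inl ⟨w', rfl, hw', ?_⟩⟩
      simp only [wordPhi, wordEps] at h ⊢
      split_ifs at h ⊢ <;> omega

theorem wordStep_append_left {i : ℕ} {u v x : List ℕ} :
    WordStep i x (u ++ v) ↔
      (∃ v', x = u ++ v' ∧ WordStep i v' v ∧ wordEps i u ≤ wordPhi i v) ∨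
        ∃ u', x = u' ++ v ∧ WordStep i u' u ∧ wordPhi i v < wordEps i u := by
  constructor
  · intro h
    have hlen : u.length ≤ x.length := by
      obtain ⟨a, b, rfl, h, -⟩ := h
      have := congrArg List.length h
      simp at this ⊢
      omega
    obtain ⟨u', v', rfl, hu'⟩ : ∃ u' v', x = u' ++ v' ∧ u'.length = u.length :=
      ⟨x.take u.length, x.drop u.length, by simp, by simp [hlen]⟩
    rcases wordStep_append.1 h with ⟨v'', h1, h2, h3⟩ | ⟨u'', h1, h2, h3⟩
    · obtain ⟨rfl, rfl⟩ := List.append_inj h1 hu'.symm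
      have := h2.phi_eps
      exact .inl ⟨v', rfl, h2, by omega⟩
    · have hl : u.length = u''.length := by
        obtain ⟨a, b, rfl, rfl, -⟩ := h2
        simp at hu' ⊢
        omega
      obtain ⟨rfl, rfl⟩ := List.append_inj h1 hl
      have := h2.phi_eps
      exact .inr ⟨u', rfl, h2, by omega⟩
  · rintro (⟨v', rfl, h, h'⟩ | ⟨u', rfl, h, h'⟩)
    · have := h.phi_eps
      exact wordStep_append.2 (.inl ⟨v, rfl, h, by omega⟩)
    · have := h.phi_eps
      exact wordStep_append.2 (.inr ⟨u, rfl, h, by omega⟩)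

theorem exists_wordStep_left {i : ℕ} {w : List ℕ} (h : 0 < wordEps i w) :
    ∃ w', WordStep i w' w := by
  induction w with
  | nil => simp [wordEps] at h
  | cons a w ih =>
    have key := fun x => wordStep_append_left (i := i) (u := [a]) (v := w) (x := x)
    simp only [List.singleton_append] at key
    simp only [key]
    by_cases ha : a = i + 1 ∧ wordPhi i w = 0
    · refine ⟨i :: w, .inr ⟨[i], rfl, ⟨[], [], rfl, by simp [ha.1], rfl, rfl⟩, ?_⟩⟩
      simp [wordEps, ha, wordPhi]
    · simp only [wordEps, ha, if_false] at h
      obtain ⟨w', hw'⟩ := ih h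
      refine ⟨a :: w', .inl ⟨w', rfl, hw', ?_⟩⟩
      simp only [wordEps]
      split_ifs <;> simp_all [wordPhi]
      omega

theorem WordStep.left_unique {i : ℕ} {w w₁ w₂ : List ℕ} (h₁ : WordStep i w₁ w)
    (h₂ : WordStep i w₂ w) : w₁ = w₂ := by
  induction w generalizing w₁ w₂ with
  | nil => obtain ⟨a, b, -, h, -⟩ := h₁; simp at h
  | cons a w ih =>
    have key := fun x => wordStep_append_left (i := i) (u := [a]) (v := w) (x := x)
    simp only [List.singleton_append] at key
    rw [key] at h₁ h₂
    have single : ∀ u, WordStep i u [a] → u = [i] := by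
      rintro u ⟨p, q, rfl, h, -⟩
      rcases p with _ | ⟨p, ps⟩
      · simp at h
        simp [h.2.symm]
      · simp at h
    rcases h₁ with ⟨v, rfl, hv, h⟩ | ⟨v, rfl, hv, h⟩ <;>
      rcases h₂ with ⟨v', rfl, hv', h'⟩ | ⟨v', rfl, hv', h'⟩
    · rw [ih hv hv']
    · omega
    · omega
    · rw [single _ hv, single _ hv']

/-! ### Isomorphisms of word crystals -/

/-- A one-to-one relation between words of length `k` that is compatible with the crystal
structure. -/
structure IsCrystalRel (k : ℕ) (R : List ℕ → List ℕ → Prop) : Prop where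
  length_left : ∀ {a b}, R a b → a.length = k
  perm : ∀ {a b}, R a b → a.Perm b
  right_unique : ∀ {a b b'}, R a b → R a b' → b = b'
  left_unique : ∀ {a a' b}, R a b → R a' b → a = a'
  eps : ∀ {a b}, R a b → ∀ i, wordEps i a = wordEps i b
  step : ∀ {a b a' b' i}, R a b → WordStep i a a' → WordStep i b b' → R a' b'
  step_left : ∀ {a b a' b' i}, R a b → WordStep i a' a → WordStep i b' b → R a' b'

theorem IsCrystalRel.phi {k : ℕ} {R : List ℕ → List ℕ → Prop} (h : IsCrystalRel k R)
    {a b : List ℕ} (hab : R a b) (i : ℕ) : wordPhi i a = wordPhi i b := by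
  have h1 := wordPhi_add_count i a
  have h2 := wordPhi_add_count i b
  have h3 := (h.perm hab).count_eq i
  have h4 := (h.perm hab).count_eq (i + 1)
  have h5 := h.eps hab i
  omega

theorem IsCrystalRel.exists_step {k : ℕ} {R : List ℕ → List ℕ → Prop} (h : IsCrystalRel k R)
    {a b a' : List ℕ} {i : ℕ} (hab : R a b) (ha : WordStep i a a') :
    ∃ b', WordStep i b b' ∧ R a' b' := by
  have h1 := ha.phi_eps
  have h2 := h.phi hab i
  obtain ⟨b', hb'⟩ := exists_wordStep (i := i) (w := b) (by omega)
  exact ⟨b', hb', h.step hab ha hb'⟩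

theorem IsCrystalRel.exists_step_left {k : ℕ} {R : List ℕ → List ℕ → Prop}
    (h : IsCrystalRel k R) {a b a' : List ℕ} {i : ℕ} (hab : R a b) (ha : WordStep i a' a) :
    ∃ b', WordStep i b' b ∧ R a' b' := by
  have h1 := ha.phi_eps
  have h2 := h.eps hab i
  obtain ⟨b', hb'⟩ := exists_wordStep_left (i := i) (w := b) (by omega)
  exact ⟨b', hb', h.step_left hab ha hb'⟩

theorem IsCrystalRel.flip {k : ℕ} {R : List ℕ → List ℕ → Prop} (hR : IsCrystalRel k R) :
    IsCrystalRel k fun x y => R y x where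
  length_left h := (hR.perm h).length_eq.symm.trans (hR.length_left h)
  perm h := (hR.perm h).symm
  right_unique h h' := hR.left_unique h h'
  left_unique h h' := hR.right_unique h h'
  eps h i := (hR.eps h i).symm
  step h h1 h2 := hR.step h h2 h1
  step_left h h1 h2 := hR.step_left h h2 h1

/-- Two words correspond under an isomorphism of their crystals. -/
def WordIso (a b : List ℕ) : Prop := ∃ k R, IsCrystalRel k R ∧ R a b

theorem WordIso.refl (a : List ℕ) : WordIso a a :=
  ⟨a.length, fun x y => x = y ∧ x.length = a.length,
    { length_left := fun h => h.2
      perm := by rintro _ _ ⟨rfl, -⟩; rfl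
      right_unique := by rintro _ _ _ ⟨rfl, -⟩ ⟨rfl, -⟩; rfl
      left_unique := by rintro _ _ _ ⟨rfl, -⟩ ⟨rfl, -⟩; rfl
      eps := by rintro _ _ ⟨rfl, -⟩ _; rfl
      step := by
        rintro x _ x' y' i ⟨rfl, hx⟩ h1 h2
        refine ⟨h1.right_unique h2, ?_⟩
        obtain ⟨p, q, rfl, rfl, -⟩ := h1
        simpa using hx
      step_left := by
        rintro x _ x' y' i ⟨rfl, hx⟩ h1 h2
        refine ⟨h1.left_unique h2, ?_⟩
        obtain ⟨p, q, rfl, rfl, -⟩ := h1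
        simpa using hx }, rfl, rfl⟩

theorem WordIso.symm {a b : List ℕ} (h : WordIso a b) : WordIso b a := by
  obtain ⟨k, R, hR, hab⟩ := h
  exact ⟨k, fun x y => R y x, hR.flip, hab⟩

theorem WordIso.trans {a b c : List ℕ} (h : WordIso a b) (h' : WordIso b c) : WordIso a c := by
  obtain ⟨k, R, hR, hab⟩ := h
  obtain ⟨k', R', hR', hbc⟩ := h'
  exact ⟨k, fun x z => ∃ y, R x y ∧ R' y z,
    { length_left := fun ⟨y, h, _⟩ => hR.length_left h
      perm := fun ⟨y, h, h'⟩ => (hR.perm h).trans (hR'.perm h')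
      right_unique := by
        rintro x z z' ⟨y, h1, h2⟩ ⟨y', h3, h4⟩
        obtain rfl := hR.right_unique h1 h3
        exact hR'.right_unique h2 h4
      left_unique := by
        rintro x z z' ⟨y, h1, h2⟩ ⟨y', h3, h4⟩
        obtain rfl := hR'.left_unique h2 h4
        exact hR.left_unique h1 h3
      eps := fun ⟨y, h, h'⟩ i => (hR.eps h i).trans (hR'.eps h' i)
      step := by
        rintro x z x' z' i ⟨y, h1, h2⟩ h3 h4
        obtain ⟨y', hy, hxy⟩ := hR.exists_step h1 h3
        exact ⟨y', hxy, hR'.step h2 hy h4⟩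
      step_left := by
        rintro x z x' z' i ⟨y, h1, h2⟩ h3 h4
        obtain ⟨y', hy, hxy⟩ := hR.exists_step_left h1 h3
        exact ⟨y', hxy, hR'.step_left h2 hy h4⟩ }, b, hab, hbc⟩

theorem WordIso.append {a b c d : List ℕ} (h : WordIso a b) (h' : WordIso c d) :
    WordIso (a ++ c) (b ++ d) := by
  obtain ⟨k, R, hR, hab⟩ := h
  obtain ⟨k', R', hR', hcd⟩ := h'
  refine ⟨k + k', fun x y => ∃ x₁ x₂ y₁ y₂, x = x₁ ++ x₂ ∧ y = y₁ ++ y₂ ∧ R x₁ y₁ ∧ R' x₂ y₂,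
    ?_, a, c, b, d, rfl, rfl, hab, hcd⟩
  have len₂ : ∀ {x y}, R x y → y.length = k := fun h =>
    (hR.perm h).length_eq.symm.trans (hR.length_left h)
  constructor
  · rintro _ _ ⟨x₁, x₂, y₁, y₂, rfl, rfl, h1, h2⟩
    simp [hR.length_left h1, hR'.length_left h2]
  · rintro _ _ ⟨x₁, x₂, y₁, y₂, rfl, rfl, h1, h2⟩
    exact (hR.perm h1).append (hR'.perm h2)
  · rintro _ _ _ ⟨x₁, x₂, y₁, y₂, rfl, rfl, h1, h2⟩ ⟨x₃, x₄, y₃, y₄, h, rfl, h3, h4⟩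
    obtain ⟨rfl, rfl⟩ := List.append_inj h ((hR.length_left h1).trans (hR.length_left h3).symm)
    rw [hR.right_unique h1 h3, hR'.right_unique h2 h4]
  · rintro _ _ _ ⟨x₁, x₂, y₁, y₂, rfl, rfl, h1, h2⟩ ⟨x₃, x₄, y₃, y₄, rfl, h, h3, h4⟩
    obtain ⟨rfl, rfl⟩ := List.append_inj h ((len₂ h1).trans (len₂ h3).symm)
    rw [hR.left_unique h1 h3, hR'.left_unique h2 h4]
  · rintro _ _ ⟨x₁, x₂, y₁, y₂, rfl, rfl, h1, h2⟩ i
    rw [(word_append i _ _).2, (word_append i _ _).2, hR.eps h1, hR'.eps h2, hR'.phi h2]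
  · rintro _ _ a' b' i ⟨x₁, x₂, y₁, y₂, rfl, rfl, h1, h2⟩ h3 h4
    have e1 := hR.eps h1 i
    have e2 := hR'.phi h2 i
    rcases wordStep_append.1 h3 with ⟨v, rfl, hv, h⟩ | ⟨v, rfl, hv, h⟩ <;>
      rcases wordStep_append.1 h4 with ⟨v', rfl, hv', h'⟩ | ⟨v', rfl, hv', h'⟩
    · exact ⟨_, _, _, _, rfl, rfl, h1, hR'.step h2 hv hv'⟩
    · omega
    · omega
    · exact ⟨_, _, _, _, rfl, rfl, hR.step h1 hv hv', h2⟩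
  · rintro _ _ a' b' i ⟨x₁, x₂, y₁, y₂, rfl, rfl, h1, h2⟩ h3 h4
    have e1 := hR.eps h1 i
    have e2 := hR'.phi h2 i
    rcases wordStep_append_left.1 h3 with ⟨v, rfl, hv, h⟩ | ⟨v, rfl, hv, h⟩ <;>
      rcases wordStep_append_left.1 h4 with ⟨v', rfl, hv', h'⟩ | ⟨v', rfl, hv', h'⟩
    · exact ⟨_, _, _, _, rfl, rfl, h1, hR'.step_left h2 hv hv'⟩
    · omega
    · omega
    · exact ⟨_, _, _, _, rfl, rfl, hR.step_left h1 hv hv', h2⟩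

/-! ### Knuth relations -/

/-- The elementary Knuth relations. -/
def KnuthRel (a b : List ℕ) : Prop :=
  ∃ x y z, (a = [y, z, x] ∧ b = [y, x, z] ∧ x < y ∧ y ≤ z) ∨
    (a = [x, z, y] ∧ b = [z, x, y] ∧ x ≤ y ∧ y < z)

theorem wordStep_triple {i p q r : ℕ} {w : List ℕ} :
    WordStep i [p, q, r] w ↔
      (p = i ∧ w = [i + 1, q, r] ∧ wordPhi i [q, r] = 0) ∨
      (q = i ∧ w = [p, i + 1, r] ∧ wordEps i [p] = 0 ∧ wordPhi i [r] = 0) ∨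
      (r = i ∧ w = [p, q, i + 1] ∧ wordEps i [p, q] = 0) := by
  constructor
  · rintro ⟨u, v, h, rfl, hu, hv⟩
    rcases u with _ | ⟨u₁, _ | ⟨u₂, _ | ⟨u₃, _ | ⟨u₄, u⟩⟩⟩⟩ <;> simp at h
    · obtain ⟨rfl, rfl⟩ := h
      simpa using hv
    · obtain ⟨rfl, rfl, rfl⟩ := h
      simp [hu, hv]
    · obtain ⟨rfl, rfl, rfl, rfl⟩ := h
      simp [hu]
  · rintro (⟨rfl, rfl, h⟩ | ⟨rfl, rfl, h, h'⟩ | ⟨rfl, rfl, h⟩)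
    · exact ⟨[], _, rfl, rfl, rfl, h⟩
    · exact ⟨[p], _, rfl, rfl, h, h'⟩
    · exact ⟨[p, q], [], rfl, rfl, h, rfl⟩

theorem knuthRel_triple {p q r p' q' r' : ℕ} :
    KnuthRel [p, q, r] [p', q', r'] ↔
      (p = p' ∧ q = r' ∧ r = q' ∧ r < p ∧ p ≤ q) ∨
        (p = q' ∧ q = p' ∧ r = r' ∧ p ≤ r ∧ r < q) := by
  simp only [KnuthRel, List.cons.injEq, and_true]
  constructor
  · rintro ⟨x, y, z, h | h⟩ <;> omega
  · rintro (h | h)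
    · exact ⟨r, p, q, by omega⟩
    · exact ⟨p, r, q, by omega⟩

theorem wordPhi_singleton_eq_zero {i p : ℕ} : wordPhi i [p] = 0 ↔ p ≠ i := by
  by_cases h : p = i <;> simp [wordPhi, h]

theorem wordEps_singleton_eq_zero {i p : ℕ} : wordEps i [p] = 0 ↔ p ≠ i + 1 := by
  by_cases h : p = i + 1 <;> simp [wordEps, wordPhi, h]

theorem wordPhi_pair_eq_zero {i p q : ℕ} :
    wordPhi i [p, q] = 0 ↔ p ≠ i ∧ (q = i → p = i + 1) := by
  by_cases h1 : p = i <;> by_cases h2 : p = i + 1 <;> by_cases h3 : q = i <;>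
    by_cases h4 : q = i + 1 <;> simp [wordPhi, *]

theorem wordEps_pair_eq_zero {i p q : ℕ} :
    wordEps i [p, q] = 0 ↔ q ≠ i + 1 ∧ (p = i + 1 → q = i) := by
  by_cases h : q = i
  · simp [wordEps, wordPhi, h]
  · by_cases h' : q = i + 1
    · simp [wordEps, wordPhi, h']
      split_ifs <;> simp
    · simp [wordEps, wordPhi, h, h']

theorem KnuthRel.step {i : ℕ} {a b a' b' : List ℕ} (h : KnuthRel a b) (ha : WordStep i a a')
    (hb : WordStep i b b') : KnuthRel a' b' := by
  obtain ⟨x, y, z, ⟨rfl, rfl, h1, h2⟩ | ⟨rfl, rfl, h1, h2⟩⟩ := h <;>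
    rw [wordStep_triple, wordPhi_pair_eq_zero, wordEps_pair_eq_zero, wordPhi_singleton_eq_zero,
      wordEps_singleton_eq_zero] at ha hb <;>
    rcases ha with ⟨e1, rfl, h3⟩ | ⟨e1, rfl, h3⟩ | ⟨e1, rfl, h3⟩ <;>
    rcases hb with ⟨e2, rfl, h4⟩ | ⟨e2, rfl, h4⟩ | ⟨e2, rfl, h4⟩ <;>
    rw [knuthRel_triple] <;> omega

theorem KnuthRel.exists_eq {a b : List ℕ} (h : KnuthRel a b) :
    ∃ p q r p' q' r', a = [p, q, r] ∧ b = [p', q', r'] := by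
  obtain ⟨x, y, z, ⟨rfl, rfl, -⟩ | ⟨rfl, rfl, -⟩⟩ := h <;> exact ⟨_, _, _, _, _, _, rfl, rfl⟩

theorem KnuthRel.step_left {i : ℕ} {a b a' b' : List ℕ} (h : KnuthRel a b)
    (ha : WordStep i a' a) (hb : WordStep i b' b) : KnuthRel a' b' := by
  obtain ⟨p, q, r, rfl⟩ : ∃ p q r, a' = [p, q, r] := by
    obtain ⟨u, v, rfl, rfl, -⟩ := ha
    rw [← List.length_eq_three]
    obtain ⟨_, _, _, _, _, _, e, -⟩ := h.exists_eq
    have := congrArg List.length e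
    simpa using this
  obtain ⟨p', q', r', rfl⟩ : ∃ p q r, b' = [p, q, r] := by
    obtain ⟨u, v, rfl, rfl, -⟩ := hb
    rw [← List.length_eq_three]
    obtain ⟨_, _, _, _, _, _, -, e⟩ := h.exists_eq
    have := congrArg List.length e
    simpa using this
  rw [wordStep_triple, wordPhi_pair_eq_zero, wordEps_pair_eq_zero, wordPhi_singleton_eq_zero,
      wordEps_singleton_eq_zero] at ha hb
  rcases ha with ⟨e1, rfl, h3⟩ | ⟨e1, rfl, h3⟩ | ⟨e1, rfl, h3⟩ <;>
    rcases hb with ⟨e2, rfl, h4⟩ | ⟨e2, rfl, h4⟩ | ⟨e2, rfl, h4⟩ <;>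
    rw [knuthRel_triple] at h ⊢ <;> omega

theorem KnuthRel.eps {a b : List ℕ} (h : KnuthRel a b) (i : ℕ) : wordEps i a = wordEps i b := by
  obtain ⟨x, y, z, ⟨rfl, rfl, h⟩ | ⟨rfl, rfl, h⟩⟩ := h <;>
    rcases (by omega : x = i ∨ x = i + 1 ∨ (x ≠ i ∧ x ≠ i + 1)) with hx | hx | ⟨hx, hx'⟩ <;>
    rcases (by omega : y = i ∨ y = i + 1 ∨ (y ≠ i ∧ y ≠ i + 1)) with hy | hy | ⟨hy, hy'⟩ <;>
    rcases (by omega : z = i ∨ z = i + 1 ∨ (z ≠ i ∧ z ≠ i + 1)) with hz | hz | ⟨hz, hz'⟩ <;>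
    first
      | omega
      | simp [wordPhi, wordEps, *]

theorem isCrystalRel_knuthRel : IsCrystalRel 3 KnuthRel := by
  constructor
  · rintro a b ⟨x, y, z, ⟨rfl, rfl, -⟩ | ⟨rfl, rfl, -⟩⟩ <;> rfl
  · rintro a b ⟨x, y, z, ⟨rfl, rfl, -⟩ | ⟨rfl, rfl, -⟩⟩
    · exact .cons _ (.swap _ _ _)
    · exact .swap _ _ _
  · rintro a b b' ⟨x, y, z, ⟨rfl, rfl, h⟩ | ⟨rfl, rfl, h⟩⟩
      ⟨x', y', z', ⟨h1, rfl, h'⟩ | ⟨h1, rfl, h'⟩⟩ <;> simp at h1 ⊢ <;> omega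
  · rintro a a' b ⟨x, y, z, ⟨rfl, rfl, h⟩ | ⟨rfl, rfl, h⟩⟩
      ⟨x', y', z', ⟨rfl, h1, h'⟩ | ⟨rfl, h1, h'⟩⟩ <;> simp at h1 ⊢ <;> omega
  · exact fun h => h.eps
  · exact fun h ha hb => h.step ha hb
  · exact fun h ha hb => h.step_left ha hb

theorem KnuthRel.wordIso {a b : List ℕ} (h : KnuthRel a b) : WordIso a b :=
  ⟨3, KnuthRel, isCrystalRel_knuthRel, h⟩

/-! ### Highest weight words -/

/-- The column word `k ⋯ 2 1`. -/
def colWord : ℕ → List ℕ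
  | 0 => []
  | k + 1 => (k + 1) :: colWord k

theorem mem_colWord {k a : ℕ} : a ∈ colWord k ↔ 1 ≤ a ∧ a ≤ k := by
  induction k with
  | zero => simp [colWord, Nat.one_le_iff_ne_zero]
  | succ k ih => simp only [colWord, List.mem_cons, ih]; omega

theorem count_colWord {k a : ℕ} (ha : 1 ≤ a) : (colWord k).count a = if a ≤ k then 1 else 0 := by
  induction k with
  | zero => rw [if_neg (by omega)]; rfl
  | succ k ih =>
    simp only [colWord, List.count_cons, ih, beq_iff_eq]
    split_ifs <;> omega

theorem WordIso.append_left (a : List ℕ) {b c : List ℕ} (h : WordIso b c) :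
    WordIso (a ++ b) (a ++ c) := (WordIso.refl a).append h

theorem WordIso.append_right {a b : List ℕ} (c : List ℕ) (h : WordIso a b) :
    WordIso (a ++ c) (b ++ c) := h.append (WordIso.refl c)

theorem wordIso_cons_cons_colWord {m x y : ℕ} (hm : m < y) (hy : y ≤ x) :
    WordIso (y :: x :: colWord m) (y :: (colWord m ++ [x])) := by
  induction m generalizing y with
  | zero => exact WordIso.refl _
  | succ m ih =>
    have h1 : WordIso [y, x, m + 1] [y, m + 1, x] :=
      KnuthRel.wordIso ⟨m + 1, y, x, .inl ⟨rfl, rfl, hm, hy⟩⟩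
    exact (h1.append_right (colWord m)).trans ((ih (Nat.lt_succ_self m) (by omega)).append_left [y])

theorem wordIso_cons_colWord {k x : ℕ} (hx : 1 ≤ x) (hk : x ≤ k) :
    WordIso (x :: colWord k) (colWord k ++ [x]) := by
  induction k with
  | zero => omega
  | succ k ih =>
    rcases Nat.lt_or_ge k x with h | h
    · obtain rfl : x = k + 1 := by omega
      exact wordIso_cons_cons_colWord (Nat.lt_succ_self k) le_rfl
    · obtain ⟨k, rfl⟩ : ∃ j, k = j + 1 := ⟨k - 1, by omega⟩
      have h1 : WordIso [x, k + 2, k + 1] [k + 2, x, k + 1] :=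
        KnuthRel.wordIso ⟨x, k + 1, k + 2, .inr ⟨rfl, rfl, h, by omega⟩⟩
      exact (h1.append_right (colWord k)).trans ((ih h).append_left [k + 2])

/-- A word annihilated by every `e_i`. -/
def IsHighestWord (w : List ℕ) : Prop := ∀ i, 1 ≤ i → wordEps i w = 0

theorem IsHighestWord.of_append {u v : List ℕ} (h : IsHighestWord (u ++ v)) : IsHighestWord v :=
  fun i hi => by
    have h1 := (word_append i u v).2
    have h2 := h i hi
    omega

theorem WordIso.eps {a b : List ℕ} (h : WordIso a b) (i : ℕ) : wordEps i a = wordEps i b := by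
  obtain ⟨k, R, hR, hab⟩ := h
  exact hR.eps hab i

theorem WordIso.perm {a b : List ℕ} (h : WordIso a b) : a.Perm b := by
  obtain ⟨k, R, hR, hab⟩ := h
  exact hR.perm hab

theorem WordIso.isHighestWord {a b : List ℕ} (h : WordIso a b) (ha : IsHighestWord a) :
    IsHighestWord b := fun i hi => (h.eps i).symm.trans (ha i hi)

/-- The concatenation of the column words of lengths given by a list. -/
def colsWord (ks : List ℕ) : List ℕ := ks.flatMap colWord

theorem exists_wordIso_colsWord_cons {x : ℕ} {ks : List ℕ} (hx : 1 ≤ x)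
    (hks : ks.Pairwise (· ≥ ·)) (hpos : ∀ k ∈ ks, 1 ≤ k)
    (hw : IsHighestWord (x :: colsWord ks)) :
    ∃ ks' : List ℕ, ks'.Pairwise (· ≥ ·) ∧ (∀ k ∈ ks', 1 ≤ k) ∧
      (∀ k ∈ ks', k ≤ x ∨ k ∈ ks) ∧ WordIso (x :: colsWord ks) (colsWord ks') := by
  have key : ∀ i, x = i + 1 → 1 ≤ i → ∃ k ∈ ks, i ≤ k := by
    rintro i rfl hi
    have h1 := hw i hi
    simp only [wordEps, true_and] at h1
    split_ifs at h1 with h2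
    by_contra! hlt
    refine h2 (wordPhi_eq_zero_of_notMem ?_)
    simp only [colsWord, List.mem_flatMap, mem_colWord, not_exists, not_and]
    intro k hk _
    have := hlt k hk
    omega
  induction ks with
  | nil =>
    obtain rfl : x = 1 := by
      by_contra hne
      obtain ⟨k, hk, -⟩ := key (x - 1) (by omega) (by omega)
      simp at hk
    exact ⟨[1], by simp, by simp, by simp, WordIso.refl _⟩
  | cons k ks ih =>
    rw [List.pairwise_cons] at hks
    have hcons : colsWord (k :: ks) = colWord k ++ colsWord ks := rfl
    rcases Nat.lt_or_ge k x with h | h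
    · have hxk : x = k + 1 := by
        by_contra hne
        obtain ⟨j, hj, hle⟩ := key (x - 1) (by omega) (by omega)
        rcases List.mem_cons.1 hj with rfl | hj
        · omega
        · have := hks.1 j hj
          omega
      refine ⟨x :: ks, ?_, ?_, ?_, ?_⟩
      · refine List.pairwise_cons.2 ⟨fun j hj => ?_, hks.2⟩
        have := hks.1 j hj
        simp only [ge_iff_le] at this ⊢
        omega
      · intro j hj
        rcases List.mem_cons.1 hj with rfl | hj
        · exact hx
        · exact hpos j (List.mem_cons_of_mem _ hj)
      · intro j hj
        rcases List.mem_cons.1 hj with rfl | hj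
        · exact .inl le_rfl
        · exact .inr (List.mem_cons_of_mem _ hj)
      · subst hxk
        exact WordIso.refl _
    · have h1 : WordIso (x :: colsWord (k :: ks)) (colWord k ++ x :: colsWord ks) := by
        have := (wordIso_cons_colWord hx h).append_right (colsWord ks)
        simpa [hcons] using this
      have h2 : IsHighestWord (x :: colsWord ks) := (h1.isHighestWord hw).of_append
      have key' : ∀ i, x = i + 1 → 1 ≤ i → ∃ k ∈ ks, i ≤ k := by
        rintro i rfl hi
        have h3 := h2 i hi
        simp only [wordEps, true_and] at h3
        split_ifs at h3 with h4
        by_contra! hlt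
        refine h4 (wordPhi_eq_zero_of_notMem ?_)
        simp only [colsWord, List.mem_flatMap, mem_colWord, not_exists, not_and]
        intro k hk _
        have := hlt k hk
        omega
      obtain ⟨ks', a1, a2, a3, a4⟩ :=
        ih hks.2 (fun j hj => hpos j (List.mem_cons_of_mem _ hj)) h2 key'
      refine ⟨k :: ks', ?_, ?_, ?_, h1.trans (a4.append_left _)⟩
      · refine List.pairwise_cons.2 ⟨fun j hj => ?_, a1⟩
        rcases a3 j hj with h3 | h3
        · exact h3.trans h
        · exact hks.1 j h3
      · intro j hj
        rcases List.mem_cons.1 hj with rfl | hj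
        · exact hpos _ (List.mem_cons_self ..)
        · exact a2 j hj
      · intro j hj
        rcases List.mem_cons.1 hj with rfl | hj
        · exact .inr (List.mem_cons_self ..)
        · exact (a3 j hj).imp_right (List.mem_cons_of_mem _)

theorem IsHighestWord.exists_wordIso_colsWord {w : List ℕ} (hw : IsHighestWord w)
    (hpos : ∀ a ∈ w, 1 ≤ a) :
    ∃ ks : List ℕ, ks.Pairwise (· ≥ ·) ∧ (∀ k ∈ ks, 1 ≤ k) ∧ WordIso w (colsWord ks) := by
  induction w with
  | nil => exact ⟨[], by simp, by simp, WordIso.refl _⟩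
  | cons x w ih =>
    obtain ⟨ks, h1, h2, h3⟩ := ih (IsHighestWord.of_append (u := [x]) hw)
      fun a ha => hpos a (List.mem_cons_of_mem _ ha)
    have h4 : WordIso (x :: w) (x :: colsWord ks) := h3.append_left [x]
    obtain ⟨ks', a1, a2, -, a4⟩ := exists_wordIso_colsWord_cons (hpos x (List.mem_cons_self ..))
      h1 h2 (h4.isHighestWord hw)
    exact ⟨ks', a1, a2, h4.trans a4⟩

theorem count_colsWord {a : ℕ} (ha : 1 ≤ a) (ks : List ℕ) :
    (colsWord ks).count a = (colsWord ks).count (a + 1) + ks.count a := by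
  induction ks with
  | nil => rfl
  | cons k ks ih =>
    have hcons : colsWord (k :: ks) = colWord k ++ colsWord ks := rfl
    rw [hcons, List.count_append, List.count_append, count_colWord ha, count_colWord (by omega),
      ih, List.count_cons]
    simp only [beq_iff_eq]
    split_ifs <;> omega

/-- Highest weight words of the same weight generate isomorphic crystals. -/
theorem IsHighestWord.wordIso {w w' : List ℕ} (hw : IsHighestWord w) (hw' : IsHighestWord w')
    (hpos : ∀ a ∈ w, 1 ≤ a) (hperm : w.Perm w') : WordIso w w' := by
  obtain ⟨ks, h1, h2, h3⟩ := hw.exists_wordIso_colsWord hpos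
  obtain ⟨ks', h1', h2', h3'⟩ :=
    hw'.exists_wordIso_colsWord fun a ha => hpos a (hperm.mem_iff.2 ha)
  have hp : (colsWord ks).Perm (colsWord ks') := h3.perm.symm.trans (hperm.trans h3'.perm)
  have hks : ks.Perm ks' := by
    rw [List.perm_iff_count]
    intro a
    rcases Nat.eq_zero_or_pos a with rfl | ha
    · rw [List.count_eq_zero_of_not_mem fun h => absurd (h2 0 h) (by omega),
        List.count_eq_zero_of_not_mem fun h => absurd (h2' 0 h) (by omega)]
    · have e1 := count_colsWord ha ks
      have e2 := count_colsWord ha ks'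
      rw [hp.count_eq, hp.count_eq] at e1
      omega
  obtain rfl : ks = ks' := hks.eq_of_pairwise (fun a b _ _ h h' => le_antisymm h' h) h1 h1'
  exact h3.trans h3'.symm

/-! ### The signature rule in terms of partial sums -/

/-- The numerical value of a column sign. -/
def signVal : Option Bool → ℤ
  | none => 0
  | some true => 1
  | some false => -1

theorem signVal_eq_one {o : Option Bool} : signVal o = 1 ↔ o = some true := by
  rcases o with _ | _ | _ <;> simp [signVal]

theorem signVal_eq_neg_one {o : Option Bool} : signVal o = -1 ↔ o = some false := by
  rcases o with _ | _ | _ <;> simp [signVal]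

theorem signVal_le_one (o : Option Bool) : signVal o ≤ 1 := by
  rcases o with _ | _ | _ <;> simp [signVal]

theorem neg_one_le_signVal (o : Option Bool) : -1 ≤ signVal o := by
  rcases o with _ | _ | _ <;> simp [signVal]

theorem mctr_spec (s : ℕ → Option Bool) (S : ℕ → ℤ) (hS : ∀ y, S (y + 1) = S y + signVal (s y))
    (c : ℕ) : (∀ x ≤ c, S x - S c ≤ mctr ((List.range c).filterMap s)) ∧
      ∃ x ≤ c, S x - S c = mctr ((List.range c).filterMap s) := by
  induction c with
  | zero => exact ⟨fun x hx => by simp [mctr, Nat.le_zero.1 hx], 0, le_rfl, by simp [mctr]⟩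
  | succ c ih =>
    obtain ⟨h1, x, hx, h2⟩ := ih
    have hc := h1 c le_rfl
    have hS := hS c
    rw [List.range_succ, List.filterMap_append]
    have key : (mctr ((List.range c).filterMap s ++ [c].filterMap s) : ℤ) =
        max 0 (mctr ((List.range c).filterMap s) - signVal (s c)) := by
      rcases hs : s c with _ | _ | _ <;> simp [mctr, signVal, hs] <;> omega
    rw [key]
    refine ⟨fun y hy => ?_, ?_⟩
    · rcases Nat.lt_or_ge c y with h | h
      · obtain rfl : y = c + 1 := by omega
        simp
      · have := h1 y h
        omega
    · by_cases h : (mctr ((List.range c).filterMap s) : ℤ) - signVal (s c) ≤ 0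
      · exact ⟨c + 1, le_rfl, by omega⟩
      · exact ⟨x, by omega, by omega⟩

theorem pctr_spec (s : ℕ → Option Bool) (S : ℕ → ℤ) (hS : ∀ y, S (y + 1) = S y + signVal (s y))
    (k a : ℕ) :
    (∀ x, a ≤ x → x ≤ a + k → S x - S a ≤ pctr ((List.range' a k).filterMap s)) ∧
      ∃ x, a ≤ x ∧ x ≤ a + k ∧ S x - S a = pctr ((List.range' a k).filterMap s) := by
  induction k generalizing a with
  | zero =>
    refine ⟨fun x hx hx' => ?_, a, le_rfl, le_rfl, by simp [pctr]⟩
    obtain rfl : x = a := by omega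
    simp
  | succ k ih =>
    obtain ⟨h1, x, hx, hx', h2⟩ := ih (a + 1)
    have hc := h1 (a + 1) le_rfl (by omega)
    have hS := hS a
    have key : (pctr ((List.range' a (k + 1)).filterMap s) : ℤ) =
        max 0 (pctr ((List.range' (a + 1) k).filterMap s) + signVal (s a)) := by
      rw [List.range'_succ]
      rcases hs : s a with _ | _ | _ <;> simp [pctr, signVal, hs] <;> omega
    rw [key]
    refine ⟨fun y hy hy' => ?_, ?_⟩
    · rcases hy.eq_or_lt with rfl | h
      · simp
      · have := h1 y h (by omega)
        omega
    · by_cases h : (pctr ((List.range' (a + 1) k).filterMap s) : ℤ) + signVal (s a) ≤ 0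
      · exact ⟨a, le_rfl, by omega, by omega⟩
      · exact ⟨x, by omega, by omega, by omega⟩

/-- The partial sums of the column signs. -/
def signSum (n : ℕ) (t : Filling) (i x : ℕ) : ℤ :=
  ∑ y ∈ Finset.range x, signVal (colSign n t i y)

theorem signSum_succ (n : ℕ) (t : Filling) (i x : ℕ) :
    signSum n t i (x + 1) = signSum n t i x + signVal (colSign n t i x) :=
  Finset.sum_range_succ _ _

theorem plusCol_iff {n N : ℕ} {t : Filling} {i c : ℕ} :
    PlusCol n N t i c ↔ c < N ∧ signSum n t i (c + 1) = signSum n t i c + 1 ∧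
      ∀ x ≤ c, signSum n t i x ≤ signSum n t i c := by
  obtain ⟨h1, x, hx, h2⟩ := mctr_spec (colSign n t i) (signSum n t i) (signSum_succ n t i) c
  have hs := signSum_succ n t i c
  rw [PlusCol, colWordBefore, ← signVal_eq_one]
  refine and_congr_right fun _ => and_congr (by omega) ⟨fun h y hy => ?_, fun h => ?_⟩
  · have := h1 y hy
    omega
  · have := h x hx
    omega

theorem minusCol_iff {n N : ℕ} {t : Filling} {i c : ℕ} :
    MinusCol n N t i c ↔ c < N ∧ signSum n t i c = signSum n t i (c + 1) + 1 ∧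
      ∀ x, c + 1 ≤ x → x ≤ N → signSum n t i x ≤ signSum n t i (c + 1) := by
  have hs := signSum_succ n t i c
  rw [MinusCol, colWordAfter, ← signVal_eq_neg_one]
  refine and_congr_right fun hN => ?_
  obtain ⟨h1, x, hx, hx', h2⟩ := pctr_spec (colSign n t i) (signSum n t i) (signSum_succ n t i)
    (N - (c + 1)) (c + 1)
  have e : (List.range N).drop (c + 1) = List.range' (c + 1) (N - (c + 1)) := by
    rw [List.range_eq_range', List.drop_range']
    simp
  rw [e]
  refine and_congr (by omega) ⟨fun h y hy hy' => ?_, fun h => ?_⟩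
  · have := h1 y hy (by omega)
    omega
  · have := h x hx (by omega)
    omega

theorem exists_least_jump {S : ℕ → ℤ} {a : ℤ} {x y : ℕ} (hS : ∀ y, S (y + 1) ≤ S y + 1)
    (hxy : x ≤ y) (hx : S x ≤ a) (hy : a < S y) :
    ∃ z, x ≤ z ∧ z < y ∧ S z = a ∧ S (z + 1) = a + 1 ∧ ∀ w, x ≤ w → w ≤ z → S w ≤ a := by
  have hex : ∃ y, x ≤ y ∧ a < S y := ⟨y, hxy, hy⟩
  obtain ⟨h1, h2⟩ := Nat.find_spec hex
  have hmin := fun m => @Nat.find_min _ _ hex m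
  have hle : Nat.find hex ≤ y := Nat.find_min' hex ⟨hxy, hy⟩
  set p := Nat.find hex
  have hp : p ≠ x := fun h => by rw [h] at h2; omega
  obtain ⟨z, hz⟩ : ∃ z, p = z + 1 := ⟨p - 1, by omega⟩
  have hw : ∀ w, x ≤ w → w ≤ z → S w ≤ a := fun w hw hw' => by
    have := hmin w (by omega)
    by_contra hlt
    exact this ⟨hw, by omega⟩
  have h3 := hw z (by omega) le_rfl
  have h4 := hS z
  rw [hz] at h2
  exact ⟨z, by omega, by omega, by omega, by omega, hw⟩

theorem exists_greatest_drop {S : ℕ → ℤ} {a : ℤ} {x y : ℕ} (hS : ∀ y, S y ≤ S (y + 1) + 1)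
    (hxy : x ≤ y) (hx : a < S x) (hy : S y ≤ a) :
    ∃ z, x ≤ z ∧ z < y ∧ S z = a + 1 ∧ S (z + 1) = a ∧ ∀ w, z + 1 ≤ w → w ≤ y → S w ≤ a := by
  obtain ⟨z, -, h2, h3, h4, h5⟩ := exists_least_jump (S := fun k => S (y - k)) (a := a)
    (x := 0) (y := y - x) (fun k => by
      rcases Nat.lt_or_ge k y with h | h
      · have := hS (y - (k + 1))
        rwa [show y - (k + 1) + 1 = y - k by omega] at this
      · rw [show y - (k + 1) = y - k by omega]; omega) (Nat.zero_le _) hy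
      (by simpa [Nat.sub_sub_self hxy] using hx)
  refine ⟨y - (z + 1), by omega, by omega, h4, ?_, fun w hw hw' => ?_⟩
  · rw [show y - (z + 1) + 1 = y - z by omega]
    exact h3
  · have := h5 (y - w) (Nat.zero_le _) (by omega)
    rwa [Nat.sub_sub_self hw'] at this

theorem signSum_succ_le (n : ℕ) (t : Filling) (i x : ℕ) :
    signSum n t i (x + 1) ≤ signSum n t i x + 1 := by
  have := signSum_succ n t i x
  have := signVal_le_one (colSign n t i x)
  omega

theorem signSum_le_succ (n : ℕ) (t : Filling) (i x : ℕ) :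
    signSum n t i x ≤ signSum n t i (x + 1) + 1 := by
  have := signSum_succ n t i x
  have := neg_one_le_signVal (colSign n t i x)
  omega

theorem fBoxCol_iff {n N : ℕ} {t : Filling} {i c : ℕ} :
    fBoxCol n N t i c ↔ c < N ∧ signSum n t i (c + 1) = signSum n t i c + 1 ∧
      (∀ x ≤ c, signSum n t i x ≤ signSum n t i c) ∧
      ∀ x, c + 1 ≤ x → x ≤ N → signSum n t i x ≤ signSum n t i (c + 1) := by
  simp only [fBoxCol, plusCol_iff]
  constructor
  · rintro ⟨⟨h1, h2, h3⟩, h4⟩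
    refine ⟨h1, h2, h3, fun x hx hxN => ?_⟩
    by_contra hlt
    obtain ⟨z, hz, hz', e1, e2, e3⟩ := exists_least_jump (signSum_succ_le n t i) hx
      le_rfl (not_le.1 hlt)
    have := h4 z ⟨by omega, by omega, fun w hw => ?_⟩
    · omega
    · rcases Nat.lt_or_ge c w with h | h
      · have := e3 w h hw
        omega
      · have := h3 w h
        omega
  · rintro ⟨h1, h2, h3, h4⟩
    refine ⟨⟨h1, h2, h3⟩, fun c' ⟨h5, h6, h7⟩ => ?_⟩
    by_contra hlt
    have := h4 (c' + 1) (by omega) (by omega)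
    have := h7 (c + 1) (by omega)
    omega

theorem eBoxCol_iff {n N : ℕ} {t : Filling} {i c : ℕ} :
    eBoxCol n N t i c ↔ c < N ∧ signSum n t i c = signSum n t i (c + 1) + 1 ∧
      (∀ x ≤ c, signSum n t i x ≤ signSum n t i c) ∧
      ∀ x, c + 1 ≤ x → x ≤ N → signSum n t i x ≤ signSum n t i (c + 1) := by
  simp only [eBoxCol, minusCol_iff]
  constructor
  · rintro ⟨⟨h1, h2, h3⟩, h4⟩
    refine ⟨h1, h2, fun x hx => ?_, h3⟩
    by_contra hlt
    obtain ⟨z, hz, hz', e1, e2, e3⟩ := exists_greatest_drop (signSum_le_succ n t i) hx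
      (not_le.1 hlt) le_rfl
    have := h4 z ⟨by omega, by omega, fun w hw hw' => ?_⟩
    · omega
    · rcases Nat.lt_or_ge c w with h | h
      · have := h3 w h hw'
        omega
      · have := e3 w hw h
        omega
  · rintro ⟨h1, h2, h3, h4⟩
    refine ⟨⟨h1, h2, h4⟩, fun c' ⟨h5, h6, h7⟩ => ?_⟩
    by_contra hlt
    have := h3 c' (by omega)
    have := h7 c (by omega) (by omega)
    omega

theorem signSum_le_zero_of_forall_not_fBoxCol {n N : ℕ} {t : Filling} {i : ℕ}
    (h : ¬ ∃ c, fBoxCol n N t i c) {x : ℕ} (hx : x ≤ N) : signSum n t i x ≤ 0 := by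
  by_contra hlt
  obtain ⟨z, -, hz', e1, e2, e3⟩ := exists_least_jump (signSum_succ_le n t i)
    (Nat.zero_le x) (a := 0) (by simp [signSum]) (not_le.1 hlt)
  have hp : PlusCol n N t i z :=
    plusCol_iff.2 ⟨by omega, by omega, fun w hw => e1 ▸ e3 w (Nat.zero_le _) hw⟩
  have hle : z ≤ N := by omega
  exact h ⟨_, Nat.findGreatest_spec (P := PlusCol n N t i) hle hp,
    fun c' hc' => Nat.le_findGreatest hc'.1.le hc'⟩

theorem signSum_le_of_forall_not_eBoxCol {n N : ℕ} {t : Filling} {i : ℕ}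
    (h : ¬ ∃ c, eBoxCol n N t i c) {x : ℕ} (hx : x ≤ N) :
    signSum n t i x ≤ signSum n t i N := by
  by_contra hlt
  obtain ⟨z, -, hz', e1, e2, e3⟩ := exists_greatest_drop (signSum_le_succ n t i)
    hx (not_le.1 hlt) le_rfl
  have hp : ∃ z, MinusCol n N t i z :=
    ⟨z, minusCol_iff.2 ⟨hz', by omega, fun w hw hw' => e2 ▸ e3 w hw hw'⟩⟩
  exact h ⟨_, Nat.find_spec hp, fun c' hc' => Nat.find_min' hp hc'⟩

theorem fBoxCol.unique {n N : ℕ} {t : Filling} {i c c' : ℕ} (h : fBoxCol n N t i c)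
    (h' : fBoxCol n N t i c') : c = c' := le_antisymm (h'.2 _ h.1) (h.2 _ h'.1)

theorem eBoxCol.unique {n N : ℕ} {t : Filling} {i c c' : ℕ} (h : eBoxCol n N t i c)
    (h' : eBoxCol n N t i c') : c = c' := le_antisymm (h.2 _ h'.1) (h'.2 _ h.1)

/-! ### Inequalities between entries -/

section

variable {n : ℕ} {lam : ℕ → ℕ} {t : Filling}

theorem IsPartitionShape.antitone (hl : IsPartitionShape n lam) : Antitone lam :=
  antitone_nat_of_succ_le hl.1

theorem IsSVT.col_lt (ht : IsSVT n lam t) {r c a : ℕ} (h : a ∈ t r c) : c < lam r := by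
  by_contra hc
  simp [ht.emptyOutside r c hc] at h

theorem IsSVT.row_lt (ht : IsSVT n lam t) (hl : IsPartitionShape n lam) {r c a : ℕ}
    (h : a ∈ t r c) : r < n := by
  by_contra hr
  have := ht.col_lt h
  rw [hl.2 r (by omega)] at this
  omega

theorem IsSVT.row_le (ht : IsSVT n lam t) {r c c' a b : ℕ} (hc : c < c') (ha : a ∈ t r c)
    (hb : b ∈ t r c') : a ≤ b := by
  induction c' generalizing b with
  | zero => omega
  | succ m ih =>
    rcases Nat.lt_or_ge c m with h | h
    · obtain ⟨d, hd⟩ := ht.boxNonempty r m (by have := ht.col_lt hb; omega)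
      exact (ih h hd).trans (ht.rowWeak _ _ _ _ hd hb)
    · obtain rfl : c = m := by omega
      exact ht.rowWeak _ _ _ _ ha hb

theorem IsSVT.col_add_le (ht : IsSVT n lam t) (hl : IsPartitionShape n lam) {r r' c a b : ℕ}
    (hr : r < r') (ha : a ∈ t r c) (hb : b ∈ t r' c) : a + (r' - r) ≤ b := by
  induction r' generalizing b with
  | zero => omega
  | succ m ih =>
    rcases Nat.lt_or_ge r m with h | h
    · obtain ⟨d, hd⟩ := ht.boxNonempty m c ((ht.col_lt hb).trans_le (hl.1 m))
      have := ih h hd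
      have := ht.colStrict _ _ _ _ hd hb
      omega
    · obtain rfl : r = m := by omega
      have := ht.colStrict _ _ _ _ ha hb
      omega

theorem IsSVT.mono (ht : IsSVT n lam t) (hl : IsPartitionShape n lam) {r r' c c' a b : ℕ}
    (ha : a ∈ t r c) (hb : b ∈ t r' c') (hr : r ≤ r') (hc : c ≤ c') (h : c < c' ∨ r < r') :
    a + (r' - r) ≤ b := by
  rcases hr.eq_or_lt with rfl | hr
  · have := ht.row_le (by omega) ha hb
    omega
  · rcases hc.eq_or_lt with rfl | hc
    · exact ht.col_add_le hl hr ha hb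
    · obtain ⟨d, hd⟩ := ht.boxNonempty r' c (hc.trans (ht.col_lt hb))
      have := ht.col_add_le hl hr ha hd
      have := ht.row_le hc hd hb
      omega

theorem IsSVT.row_unique (ht : IsSVT n lam t) (hl : IsPartitionShape n lam) {r r' c a : ℕ}
    (ha : a ∈ t r c) (hb : a ∈ t r' c) : r = r' := by
  rcases lt_trichotomy r r' with h | h | h
  · have := ht.col_add_le hl h ha hb
    omega
  · exact h
  · have := ht.col_add_le hl h hb ha
    omega

theorem IsSVT.sum_row_mem (ht : IsSVT n lam t) (hl : IsPartitionShape n lam) (a c : ℕ) :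
    ∑ k ∈ Finset.range n, (if a ∈ t k c then (1 : ℤ) else 0) = if colHas n t a c then 1 else 0 := by
  split_ifs with h
  · obtain ⟨r, hr, ha⟩ := h
    rw [Finset.sum_eq_single r (fun k _ hk => if_neg fun hk' => hk (ht.row_unique hl hk' ha))
      (fun h => absurd (Finset.mem_range.2 hr) h), if_pos ha]
  · exact Finset.sum_eq_zero fun k hk => if_neg fun hk' => h ⟨k, Finset.mem_range.1 hk, hk'⟩

/-- The contribution of a box to the sign of its column. -/
def boxVal (t : Filling) (i r c : ℕ) : ℤ :=
  (if i ∈ t r c then 1 else 0) - if i + 1 ∈ t r c then 1 else 0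

theorem IsSVT.signVal_colSign (ht : IsSVT n lam t) (hl : IsPartitionShape n lam) (i c : ℕ) :
    signVal (colSign n t i c) = ∑ k ∈ Finset.range n, boxVal t i k c := by
  simp only [boxVal, Finset.sum_sub_distrib, ht.sum_row_mem hl]
  by_cases h : colHas n t i c <;> by_cases h' : colHas n t (i + 1) c <;>
    simp [colSign, h, h', signVal]

end

/-! ### The crystal operators on tableaux -/

section

variable {n : ℕ} {lam : ℕ → ℕ} {i : ℕ} {t t' : Filling} {r c : ℕ}

/-- The result of applying `f_i` at the box in row `r` and column `c`. -/
def fTarget (i : ℕ) (t : Filling) (r c : ℕ) : Filling :=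
  if i ∈ t r (c + 1) then
    updateBox (updateBox t r (c + 1) ((t r (c + 1)).erase i)) r c (insert (i + 1) (t r c))
  else updateBox t r c (insert (i + 1) ((t r c).erase i))

/-- The column from which `f_i` removes an `i`. -/
def fCol (i : ℕ) (t : Filling) (r c : ℕ) : ℕ := if i ∈ t r (c + 1) then c + 1 else c

/-- The result of applying `e_i` at the box in row `r` and column `c`. -/
def eTarget (i : ℕ) (t : Filling) (r c : ℕ) : Filling :=
  if 0 < c ∧ (i + 1) ∈ t r (c - 1) then
    updateBox (updateBox t r (c - 1) ((t r (c - 1)).erase (i + 1))) r c (insert i (t r c))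
  else updateBox t r c (insert i ((t r c).erase (i + 1)))

/-- The column from which `e_i` removes an `i + 1`. -/
def eCol (i : ℕ) (t : Filling) (r c : ℕ) : ℕ :=
  if 0 < c ∧ (i + 1) ∈ t r (c - 1) then c - 1 else c

theorem mem_fTarget {a k z : ℕ} : a ∈ fTarget i t r c k z ↔
    (a ∈ t k z ∧ ¬ (k = r ∧ z = fCol i t r c ∧ a = i)) ∨ (k = r ∧ z = c ∧ a = i + 1) := by
  unfold fTarget fCol
  split_ifs with h <;> simp only [updateBox] <;>
    [split_ifs with h1 h2; split_ifs with h1]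
  · obtain ⟨rfl, rfl⟩ := h1
    simp; tauto
  · obtain ⟨rfl, rfl⟩ := h2
    simp; tauto
  · simp; tauto
  · obtain ⟨rfl, rfl⟩ := h1
    simp; tauto
  · simp; tauto

theorem mem_eTarget {a k z : ℕ} : a ∈ eTarget i t r c k z ↔
    (a ∈ t k z ∧ ¬ (k = r ∧ z = eCol i t r c ∧ a = i + 1)) ∨ (k = r ∧ z = c ∧ a = i) := by
  unfold eTarget eCol
  split_ifs with h <;> simp only [updateBox] <;>
    [split_ifs with h1 h2; split_ifs with h1]
  · obtain ⟨rfl, rfl⟩ := h1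
    simp; grind
  · obtain ⟨rfl, rfl⟩ := h2
    simp; grind
  · simp; tauto
  · obtain ⟨rfl, rfl⟩ := h1
    simp; tauto
  · simp; tauto

theorem fBoxCol.colHas {N : ℕ} (h : fBoxCol n N t i c) : SVTCrystal.colHas n t i c := by
  have := h.1.2.1
  unfold colSign at this
  split_ifs at this with h1
  · exact h1.1
  · simp at this

theorem fBoxCol.not_colHas {N : ℕ} (h : fBoxCol n N t i c) : ¬ SVTCrystal.colHas n t (i + 1) c := by
  have := h.1.2.1
  unfold colSign at this
  split_ifs at this with h1
  · exact h1.2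
  · simp at this

theorem eBoxCol.colHas {N : ℕ} (h : eBoxCol n N t i c) : SVTCrystal.colHas n t (i + 1) c := by
  have := h.1.2.1
  unfold colSign at this
  split_ifs at this with h1 h2
  · simp at this
  · exact h2.1

theorem eBoxCol.not_colHas {N : ℕ} (h : eBoxCol n N t i c) : ¬ SVTCrystal.colHas n t i c := by
  have := h.1.2.1
  unfold colSign at this
  split_ifs at this with h1 h2
  · simp at this
  · exact h2.2

theorem fRaw_eq_none_iff : fRaw n lam i t = none ↔ ¬ ∃ c, fBoxCol n (lam 0) t i c := by
  unfold fRaw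
  split_ifs with h
  · have := (Classical.choose_spec h).colHas
    simp only [h, not_true, iff_false]
    split_ifs <;> simp
    contradiction
  · simp [h]

theorem eRaw_eq_none_iff : eRaw n lam i t = none ↔ ¬ ∃ c, eBoxCol n (lam 0) t i c := by
  unfold eRaw
  split_ifs with h
  · have := (Classical.choose_spec h).colHas
    simp only [h, not_true, iff_false]
    split_ifs <;> simp
    contradiction
  · simp [h]

theorem exists_of_fRaw_eq_some (h : fRaw n lam i t = some t') :
    ∃ r c, fBoxCol n (lam 0) t i c ∧ r < n ∧ i ∈ t r c ∧ t' = fTarget i t r c := by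
  unfold fRaw at h
  split_ifs at h with h1
  have hc := Classical.choose_spec h1
  generalize Classical.choose h1 = c at *
  dsimp only at h
  split_ifs at h with h2 h3
  all_goals
    have hr := Classical.choose_spec h2
    generalize Classical.choose h2 = r at *
    refine ⟨r, c, hc, hr.1, hr.2, ?_⟩
    simp [fTarget, h3] at h ⊢
    exact h.symm

theorem exists_of_eRaw_eq_some (h : eRaw n lam i t = some t') :
    ∃ r c, eBoxCol n (lam 0) t i c ∧ r < n ∧ i + 1 ∈ t r c ∧ t' = eTarget i t r c := by
  unfold eRaw at h
  split_ifs at h with h1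
  have hc := Classical.choose_spec h1
  generalize Classical.choose h1 = c at *
  dsimp only at h
  split_ifs at h with h2 h3
  all_goals
    have hr := Classical.choose_spec h2
    generalize Classical.choose h2 = r at *
    refine ⟨r, c, hc, hr.1, hr.2, ?_⟩
    simp only [eTarget, h3, if_false, Option.some.injEq] at h ⊢
    exact h.symm

theorem IsSVT.fRaw_eq_some (ht : IsSVT n lam t) (hl : IsPartitionShape n lam)
    (hc : fBoxCol n (lam 0) t i c) (hr : i ∈ t r c) :
    fRaw n lam i t = some (fTarget i t r c) := by
  rcases h : fRaw n lam i t with _ | t'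
  · exact absurd ⟨c, hc⟩ (fRaw_eq_none_iff.1 h)
  · obtain ⟨r', c', hc', -, hr', rfl⟩ := exists_of_fRaw_eq_some h
    obtain rfl := hc.unique hc'
    obtain rfl := ht.row_unique hl hr hr'
    rfl

theorem IsSVT.notMem_of_fBoxCol (ht : IsSVT n lam t) (hl : IsPartitionShape n lam) {N : ℕ}
    (hc : fBoxCol n N t i c) (k : ℕ) : i + 1 ∉ t k c :=
  fun h => hc.not_colHas ⟨k, ht.row_lt hl h, h⟩

theorem IsSVT.notMem_of_eBoxCol (ht : IsSVT n lam t) (hl : IsPartitionShape n lam) {N : ℕ}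
    (hc : eBoxCol n N t i c) (k : ℕ) : i ∉ t k c :=
  fun h => hc.not_colHas ⟨k, ht.row_lt hl h, h⟩

theorem IsSVT.succ_mem_of_fBoxCol (ht : IsSVT n lam t) (hl : IsPartitionShape n lam)
    (hc : fBoxCol n (lam 0) t i c) (hr : i ∈ t r c) (hr' : i ∈ t r (c + 1)) :
    i + 1 ∈ t r (c + 1) := by
  have h1 := (fBoxCol_iff.1 hc).2.2.2 (c + 1 + 1) (by omega)
    ((ht.col_lt hr').trans_le (hl.antitone (Nat.zero_le _)))
  have h2 := signSum_succ n t i (c + 1)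
  have h3 : SVTCrystal.colHas n t (i + 1) (c + 1) := by
    by_contra h3
    have : colSign n t i (c + 1) = some true := if_pos ⟨⟨r, ht.row_lt hl hr', hr'⟩, h3⟩
    rw [this] at h2
    simp only [signVal] at h2
    omega
  obtain ⟨k, -, hk⟩ := h3
  rcases lt_trichotomy k r with h | rfl | h
  · have := ht.col_add_le hl h hk hr'
    omega
  · exact hk
  · have := ht.col_add_le hl h hr' hk
    obtain rfl : k = r + 1 := by omega
    obtain ⟨d, hd⟩ := ht.boxNonempty (r + 1) c (by have := ht.col_lt hk; omega)
    have := ht.colStrict _ _ _ _ hr hd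
    have := ht.rowWeak _ _ _ _ hd hk
    obtain rfl : d = i + 1 := by omega
    exact absurd hd (ht.notMem_of_fBoxCol hl hc _)

theorem IsSVT.mem_of_eBoxCol (ht : IsSVT n lam t) (hl : IsPartitionShape n lam)
    (hc : eBoxCol n (lam 0) t i (c + 1)) (hr : i + 1 ∈ t r (c + 1)) (hr' : i + 1 ∈ t r c) :
    i ∈ t r c := by
  have h1 := (eBoxCol_iff.1 hc).2.2.1 c (by omega)
  have h2 := signSum_succ n t i c
  have h3 : SVTCrystal.colHas n t i c := by
    by_contra h3
    have : colSign n t i c = some false := by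
      rw [colSign, if_neg (fun h => h3 h.1), if_pos ⟨⟨r, ht.row_lt hl hr', hr'⟩, h3⟩]
    rw [this] at h2
    simp only [signVal] at h2
    omega
  obtain ⟨k, -, hk⟩ := h3
  rcases lt_trichotomy k r with h | rfl | h
  · have := ht.col_add_le hl h hk hr'
    obtain rfl : r = k + 1 := by omega
    obtain ⟨d, hd⟩ := ht.boxNonempty k (c + 1) ((ht.col_lt hr).trans_le (hl.1 k))
    have := ht.colStrict _ _ _ _ hd hr
    have := ht.rowWeak _ _ _ _ hk hd
    obtain rfl : d = i := by omega
    exact absurd hd (ht.notMem_of_eBoxCol hl hc _)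
  · exact hk
  · have := ht.col_add_le hl h hr' hk
    omega

theorem fCol_eq (i : ℕ) (t : Filling) (r c : ℕ) :
    fCol i t r c = c ∧ i ∉ t r (c + 1) ∨ fCol i t r c = c + 1 ∧ i ∈ t r (c + 1) := by
  unfold fCol; split_ifs with h <;> simp [h]

theorem eCol_eq (i : ℕ) (t : Filling) (r c : ℕ) :
    eCol i t r c = c ∧ (0 < c → i + 1 ∉ t r (c - 1)) ∨
      eCol i t r c + 1 = c ∧ i + 1 ∈ t r (eCol i t r c) := by
  unfold eCol; split_ifs with h
  · exact .inr ⟨by omega, h.2⟩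
  · exact .inl ⟨rfl, fun h' h'' => h ⟨h', h''⟩⟩

theorem IsSVT.fTarget (ht : IsSVT n lam t) (hl : IsPartitionShape n lam) (hi : i < n)
    (hc : fBoxCol n (lam 0) t i c) (hr : i ∈ t r c) : IsSVT n lam (fTarget i t r c) := by
  have hno := ht.notMem_of_fBoxCol hl hc
  have hcol := fCol_eq i t r c
  constructor
  · intro k z hz
    by_cases h : k = r ∧ z = c
    · exact ⟨i + 1, mem_fTarget.2 (.inr ⟨h.1, h.2, rfl⟩)⟩
    by_cases h' : k = r ∧ z = c + 1 ∧ i ∈ t r (c + 1)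
    · obtain ⟨rfl, rfl, h'⟩ := h'
      exact ⟨i + 1, mem_fTarget.2 (.inl ⟨ht.succ_mem_of_fBoxCol hl hc hr h', by omega⟩)⟩
    · obtain ⟨a, ha⟩ := ht.boxNonempty k z hz
      refine ⟨a, mem_fTarget.2 (.inl ⟨ha, fun h'' => ?_⟩)⟩
      rcases hcol with h1 | h1
      · omega
      · exact h' ⟨h''.1, by omega, h1.2⟩
  · intro k z hz
    refine Finset.eq_empty_of_forall_notMem fun a ha => ?_
    rcases mem_fTarget.1 ha with h | ⟨rfl, rfl, -⟩
    · exact hz (ht.col_lt h.1)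
    · exact hz (ht.col_lt hr)
  · intro k z a ha
    rcases mem_fTarget.1 ha with h | ⟨rfl, rfl, rfl⟩
    · exact ht.entryBounds _ _ _ h.1
    · omega
  · intro k z a b ha hb
    rcases mem_fTarget.1 ha with ⟨ha₁, -⟩ | ⟨rfl, rfl, rfl⟩ <;>
      rcases mem_fTarget.1 hb with ⟨hb₁, hb'⟩ | ⟨hk, hz, rfl⟩
    · exact ht.rowWeak _ _ _ _ ha₁ hb₁
    · subst hk; subst hz
      exact (ht.rowWeak _ _ _ _ ha₁ hr).trans (Nat.le_succ _)
    · have := ht.rowWeak _ _ _ _ hr hb₁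
      rcases this.eq_or_lt with rfl | h
      · rcases hcol with h | h
        · exact absurd hb₁ h.2
        · omega
      · exact h
    · omega
  · intro k z a b ha hb
    rcases mem_fTarget.1 ha with ⟨ha₁, -⟩ | ⟨rfl, rfl, rfl⟩ <;>
      rcases mem_fTarget.1 hb with ⟨hb₁, hb'⟩ | ⟨hk, hz, rfl⟩
    · exact ht.colStrict _ _ _ _ ha₁ hb₁
    · subst hk; subst hz
      exact (ht.colStrict _ _ _ _ ha₁ hr).trans (Nat.lt_succ_self _)
    · have := ht.colStrict _ _ _ _ hr hb₁
      have : b ≠ i + 1 := fun h => hno _ (h ▸ hb₁)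
      omega
    · omega

theorem IsSVT.eTarget (ht : IsSVT n lam t) (hl : IsPartitionShape n lam) (hi : 1 ≤ i) (hin : i < n)
    (hc : eBoxCol n (lam 0) t i c) (hr : i + 1 ∈ t r c) : IsSVT n lam (eTarget i t r c) := by
  have hno := ht.notMem_of_eBoxCol hl hc
  have hcol := eCol_eq i t r c
  constructor
  · intro k z hz
    by_cases h : k = r ∧ z = c
    · exact ⟨i, mem_eTarget.2 (.inr ⟨h.1, h.2, rfl⟩)⟩
    by_cases h' : k = r ∧ z + 1 = c ∧ i + 1 ∈ t r z
    · obtain ⟨rfl, rfl, h'⟩ := h'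
      exact ⟨i, mem_eTarget.2 (.inl ⟨ht.mem_of_eBoxCol hl hc hr h', by omega⟩)⟩
    · obtain ⟨a, ha⟩ := ht.boxNonempty k z hz
      refine ⟨a, mem_eTarget.2 (.inl ⟨ha, fun h'' => ?_⟩)⟩
      rcases hcol with h1 | h1
      · omega
      · rw [← h''.2.1] at h1
        exact h' ⟨h''.1, h1.1, h1.2⟩
  · intro k z hz
    refine Finset.eq_empty_of_forall_notMem fun a ha => ?_
    rcases mem_eTarget.1 ha with h | ⟨rfl, rfl, -⟩
    · exact hz (ht.col_lt h.1)
    · exact hz (ht.col_lt hr)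
  · intro k z a ha
    rcases mem_eTarget.1 ha with h | ⟨rfl, rfl, rfl⟩
    · exact ht.entryBounds _ _ _ h.1
    · omega
  · intro k z a b ha hb
    rcases mem_eTarget.1 ha with ⟨ha₁, ha'⟩ | ⟨rfl, rfl, rfl⟩ <;>
      rcases mem_eTarget.1 hb with ⟨hb₁, hb'⟩ | ⟨hk, hz, rfl⟩
    · exact ht.rowWeak _ _ _ _ ha₁ hb₁
    · subst hk; subst hz
      have := ht.rowWeak _ _ _ _ ha₁ hr
      rcases this.eq_or_lt with rfl | h
      · rcases hcol with h | h
        · exact absurd ha₁ (by simpa using h.2)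
        · omega
      · omega
    · have := ht.rowWeak _ _ _ _ hr hb₁
      omega
    · omega
  · intro k z a b ha hb
    rcases mem_eTarget.1 ha with ⟨ha₁, -⟩ | ⟨rfl, rfl, rfl⟩ <;>
      rcases mem_eTarget.1 hb with ⟨hb₁, hb'⟩ | ⟨hk, hz, rfl⟩
    · exact ht.colStrict _ _ _ _ ha₁ hb₁
    · subst hk; subst hz
      have := ht.colStrict _ _ _ _ ha₁ hr
      have : a ≠ b := fun h => hno _ (h ▸ ha₁)
      omega
    · have := ht.colStrict _ _ _ _ hr hb₁
      omega
    · omega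

theorem IsSVT.signSum_eTarget (ht : IsSVT n lam t) (hl : IsPartitionShape n lam) (hi : 1 ≤ i)
    (hin : i < n) (hc : eBoxCol n (lam 0) t i c) (hr : i + 1 ∈ t r c) (x : ℕ) :
    signSum n (SVTCrystal.eTarget i t r c) i x =
      signSum n t i x + (if eCol i t r c < x then 1 else 0) + if c < x then 1 else 0 := by
  have hno := ht.notMem_of_eBoxCol hl hc
  have hcol := eCol_eq i t r c
  have hy : i + 1 ∈ t r (eCol i t r c) := by
    rcases hcol with h | h
    · rwa [h.1]
    · exact h.2
  have hbox : ∀ k z, boxVal (SVTCrystal.eTarget i t r c) i k z =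
      boxVal t i k z + if k = r then (if z = eCol i t r c then 1 else 0) +
        (if z = c then 1 else 0) else 0 := by
    intro k z
    simp only [boxVal, mem_eTarget]
    by_cases hk : k = r
    · subst hk
      by_cases h1 : z = eCol i t k c
      · by_cases h2 : z = c
        · subst h2
          have : i + 1 ∈ t k z := h1 ▸ hy
          simp [← h1, this, hno k]
        · have : i + 1 ∈ t k z := h1 ▸ hy
          simp [h2, ← h1, this]
      · by_cases h2 : z = c
        · subst h2
          simp [h1, hno k, sub_eq_neg_add]
        · simp [h1, h2]
    · simp [hk]
  have hcolv : ∀ z, signVal (colSign n (SVTCrystal.eTarget i t r c) i z) =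
      signVal (colSign n t i z) + ((if z = eCol i t r c then 1 else 0) +
        (if z = c then 1 else 0)) := by
    intro z
    rw [ht.signVal_colSign hl, (ht.eTarget hl hi hin hc hr).signVal_colSign hl]
    simp only [hbox, Finset.sum_add_distrib, Finset.sum_ite_eq', Finset.mem_range,
      if_pos (ht.row_lt hl hr)]
  simp only [signSum, hcolv, Finset.sum_add_distrib, Finset.sum_ite_eq', Finset.mem_range]
  ring

theorem IsSVT.fRaw_eTarget (ht : IsSVT n lam t) (hl : IsPartitionShape n lam) (hi : 1 ≤ i)
    (hin : i < n) (hc : eBoxCol n (lam 0) t i c) (hr : i + 1 ∈ t r c) :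
    fRaw n lam i (SVTCrystal.eTarget i t r c) = some t := by
  have hS := ht.signSum_eTarget hl hi hin hc hr
  have ht' := ht.eTarget hl hi hin hc hr
  have hno := ht.notMem_of_eBoxCol hl hc
  have hcol := eCol_eq i t r c
  obtain ⟨h1, h2, h3, h4⟩ := eBoxCol_iff.1 hc
  have hy : i + 1 ∈ t r (eCol i t r c) := by
    rcases hcol with h | h
    · rwa [h.1]
    · exact h.2
  have hy' : i ∈ SVTCrystal.eTarget i t r c r (eCol i t r c) := by
    rcases hcol with h | h
    · exact mem_eTarget.2 (.inr ⟨rfl, h.1, rfl⟩)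
    · refine mem_eTarget.2 (.inl ⟨?_, by omega⟩)
      rw [← h.1] at hc hr
      exact ht.mem_of_eBoxCol hl hc hr h.2
  have hmid : ∀ x, x ≤ c → eCol i t r c ≤ x → signSum n t i x = signSum n t i c := by
    intro x hx hx'
    rcases hcol with h | h
    · rw [show x = c by omega]
    · rcases hx.eq_or_lt with rfl | hlt
      · rfl
      · obtain rfl : x = eCol i t r c := by omega
        have hm := ht.mem_of_eBoxCol hl (h.1.symm ▸ hc) (h.1.symm ▸ hr) h.2
        have := signSum_succ n t i (eCol i t r c)
        rw [h.1] at this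
        have hn := ht.row_lt hl hm
        rw [this, colSign, if_neg (fun h' => h'.2 ⟨r, hn, h.2⟩),
          if_neg (fun h' => h'.2 ⟨r, hn, hm⟩)]
        simp [signVal]
  have hle : eCol i t r c ≤ c := by omega
  have hc' : fBoxCol n (lam 0) (SVTCrystal.eTarget i t r c) i (eCol i t r c) := by
    have hm := hmid (eCol i t r c) hle le_rfl
    refine fBoxCol_iff.2 ⟨by omega, ?_, fun x hx => ?_, fun x hx hx' => ?_⟩
    · rw [hS, hS]
      rcases hcol with h | h
      · rw [h.1]; simp; omega
      · rw [h.1]; simp [show ¬ c < eCol i t r c by omega]; omega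
    · have := h3 x (by omega)
      rw [hS, hS]
      split_ifs <;> omega
    · rw [hS, hS]
      rcases Nat.lt_or_ge c x with hcx | hcx
      · have := h4 x hcx hx'
        rcases hcol with h | h
        · rw [h.1]
          split_ifs <;> omega
        · rw [h.1]
          split_ifs <;> omega
      · rw [show x = c by omega, show eCol i t r c + 1 = c by omega]
  rw [ht'.fRaw_eq_some hl hc' hy', Option.some.injEq]
  have hf : fCol i (SVTCrystal.eTarget i t r c) r (eCol i t r c) = c := by
    unfold fCol
    rcases hcol with h | h
    · rw [h.1, if_neg]
      intro h'
      rcases mem_eTarget.1 h' with h' | h'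
      · have := ht.rowWeak _ _ _ _ hr h'.1
        omega
      · omega
    · rw [h.1, if_pos (mem_eTarget.2 (.inr ⟨rfl, rfl, rfl⟩))]
  funext k z
  ext a
  rw [mem_fTarget, hf, mem_eTarget]
  constructor
  · rintro (⟨⟨h, -⟩ | h, h'⟩ | ⟨rfl, rfl, rfl⟩)
    · exact h
    · exact absurd h h'
    · exact hy
  · intro h
    by_cases h' : k = r ∧ z = eCol i t r c ∧ a = i + 1
    · exact .inr h'
    · refine .inl ⟨.inl ⟨h, h'⟩, ?_⟩
      rintro ⟨rfl, rfl, rfl⟩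
      exact hno _ h

end

/-! ### Row reading words -/

/-- The minimum of the box in row `r` and column `c`. -/
def boxMin (t : Filling) (r c : ℕ) : ℕ := sInf (t r c : Set ℕ)

/-- The non-minimal entries of row `r`. -/
def rowExtra (lam : ℕ → ℕ) (t : Filling) (r : ℕ) : Finset ℕ :=
  (Finset.range (lam r)).biUnion fun c => (t r c).erase (boxMin t r c)

/-- The reading word of row `r`: the non-minimal entries in decreasing order, followed by the
minima of the boxes from left to right. -/
def rowWord (lam : ℕ → ℕ) (t : Filling) (r : ℕ) : List ℕ :=
  (rowExtra lam t r).sort (· ≥ ·) ++ (List.range (lam r)).map (boxMin t r)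

/-- The concatenation of the reading words of the rows `a + d - 1, …, a + 1, a`. -/
def rowsWord (lam : ℕ → ℕ) (t : Filling) (a : ℕ) : ℕ → List ℕ
  | 0 => []
  | d + 1 => rowWord lam t (a + d) ++ rowsWord lam t a d

/-- The number of columns in `I` whose box in row `r` contains `a`. -/
def rowCount (t : Filling) (a r : ℕ) (I : Finset ℕ) : ℕ := (I.filter fun y => a ∈ t r y).card

theorem rowCount_mono {t : Filling} {a r : ℕ} {I J : Finset ℕ}
    (h : ∀ y ∈ I, a ∈ t r y → y ∈ J) : rowCount t a r I ≤ rowCount t a r J := by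
  refine Finset.card_le_card fun y hy => ?_
  rw [Finset.mem_filter] at hy ⊢
  exact ⟨h y hy.1 hy.2, hy.2⟩

theorem rowCount_eq_zero {t : Filling} {a r : ℕ} {I : Finset ℕ} :
    rowCount t a r I = 0 ↔ ∀ y ∈ I, a ∉ t r y := by
  rw [rowCount, Finset.card_eq_zero, Finset.filter_eq_empty_iff]

theorem sum_boxVal (t : Filling) (i r : ℕ) (I : Finset ℕ) :
    ∑ y ∈ I, boxVal t i r y = (rowCount t i r I : ℤ) - rowCount t (i + 1) r I := by
  simp [boxVal, rowCount, Finset.sum_sub_distrib]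

theorem append_eq_append_cons {A B s₁ s₂ : List ℕ} {p : ℕ} (h : A ++ B = s₁ ++ p :: s₂) :
    (∃ v, A = s₁ ++ p :: v ∧ s₂ = v ++ B) ∨ ∃ u, s₁ = A ++ u ∧ B = u ++ p :: s₂ := by
  rcases List.append_eq_append_iff.1 h with ⟨u, h1, h2⟩ | ⟨u, h1, h2⟩
  · exact .inr ⟨u, h1, h2⟩
  · rcases u with _ | ⟨x, u⟩
    · exact .inr ⟨[], by simpa using h1.symm, by simpa using h2.symm⟩
    · simp only [List.cons_append, List.cons.injEq] at h2
      obtain ⟨rfl, rfl⟩ := h2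
      exact .inl ⟨u, h1, rfl⟩

theorem range_split {m x : ℕ} (hx : x < m) :
    List.range m = List.range x ++ x :: List.range' (x + 1) (m - (x + 1)) := by
  rw [List.range_eq_range', List.range_eq_range', ← List.range'_succ]
  have := (List.range'_append (s := 0) (m := x) (n := m - (x + 1) + 1) (step := 1)).symm
  simp only [one_mul, zero_add] at this
  rw [← this]
  congr 1
  omega

theorem map_range_eq_append_cons {f : ℕ → ℕ} {m p : ℕ} {u v : List ℕ}
    (h : (List.range m).map f = u ++ p :: v) :
    ∃ x < m, f x = p ∧ u = (List.range x).map f ∧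
      v = (List.range' (x + 1) (m - (x + 1))).map f := by
  have hlen := congrArg List.length h
  simp only [List.length_map, List.length_range, List.length_append, List.length_cons] at hlen
  rw [range_split (x := u.length) (by omega), List.map_append, List.map_cons] at h
  obtain ⟨h1, h2⟩ := List.append_inj h (by simp)
  simp only [List.cons.injEq] at h2
  exact ⟨u.length, by omega, h2.1, h1.symm, h2.2.symm⟩

theorem count_map_range' (f : ℕ → ℕ) (a m b : ℕ) :
    ((List.range' a m).map f).count b = ((Finset.Ico a (a + m)).filter fun y => f y = b).card := by
  induction m with
  | zero => simp
  | succ m ih =>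
    rw [List.range'_concat, List.map_append, List.count_append, ih, ← add_assoc,
      ← Finset.insert_Ico_right_eq_Ico_add_one (by omega), Finset.filter_insert]
    by_cases h : f (a + m) = b <;> simp [h]

theorem count_map_range (f : ℕ → ℕ) (m b : ℕ) :
    ((List.range m).map f).count b = ((Finset.range m).filter fun y => f y = b).card := by
  have := count_map_range' f 0 m b
  rwa [← List.range_eq_range', zero_add, ← Finset.range_eq_Ico] at this

theorem count_sort (S : Finset ℕ) (a : ℕ) :
    (S.sort (· ≥ ·)).count a = if a ∈ S then 1 else 0 := by
  split_ifs with h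
  · exact List.count_eq_one_of_mem (Finset.sort_nodup _ _) ((Finset.mem_sort _).2 h)
  · exact List.count_eq_zero_of_not_mem fun h' => h ((Finset.mem_sort _).1 h')

theorem sort_eq_append_cons {S : Finset ℕ} {u v : List ℕ} {p : ℕ}
    (h : S.sort (· ≥ ·) = u ++ p :: v) : (∀ a ∈ u, p < a) ∧ ∀ a ∈ v, a < p := by
  have hs := Finset.sortedGT_sort S
  have hs := (List.sortedGT_iff_pairwise).1 hs
  rw [h, List.pairwise_append, List.pairwise_cons] at hs
  exact ⟨fun a ha => hs.2.2 a ha p (by simp), fun a ha => hs.2.1.1 a ha⟩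

section

variable {n : ℕ} {lam : ℕ → ℕ} {t : Filling} {r i : ℕ}

theorem boxMin_mem {c : ℕ} (h : (t r c).Nonempty) : boxMin t r c ∈ t r c := by
  have := Nat.sInf_mem (s := (t r c : Set ℕ)) (by simpa using h)
  simpa [boxMin] using this

theorem boxMin_le {c a : ℕ} (h : a ∈ t r c) : boxMin t r c ≤ a :=
  Nat.sInf_le (by simpa using h)

theorem boxMin_eq {c a : ℕ} (h : a ∈ t r c) (h' : ∀ b ∈ t r c, a ≤ b) : boxMin t r c = a :=
  le_antisymm (boxMin_le h) (h' _ (boxMin_mem ⟨a, h⟩))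

theorem mem_rowExtra {a : ℕ} :
    a ∈ rowExtra lam t r ↔ ∃ c < lam r, a ∈ t r c ∧ boxMin t r c < a := by
  simp only [rowExtra, Finset.mem_biUnion, Finset.mem_range, Finset.mem_erase]
  refine exists_congr fun c => and_congr_right fun _ => ⟨fun h => ?_, fun h => ?_⟩
  · exact ⟨h.2, lt_of_le_of_ne (boxMin_le h.2) (Ne.symm h.1)⟩
  · exact ⟨h.2.ne', h.1⟩

theorem IsSVT.le_boxMin (ht : IsSVT n lam t) {c c' a : ℕ} (ha : a ∈ t r c) (hc : c < c')
    (hc' : c' < lam r) : a ≤ boxMin t r c' :=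
  ht.row_le hc ha (boxMin_mem (ht.boxNonempty _ _ hc'))

theorem IsSVT.boxMin_mem' (ht : IsSVT n lam t) {c : ℕ} (hc : c < lam r) : boxMin t r c ∈ t r c :=
  boxMin_mem (ht.boxNonempty _ _ hc)

theorem IsSVT.boxMin_eq_of_le (ht : IsSVT n lam t) {c c' a : ℕ} (ha : a ∈ t r c) (hc : c < c')
    (ha' : a ∈ t r c') : boxMin t r c' = a :=
  le_antisymm (boxMin_le ha') (ht.le_boxMin ha hc (ht.col_lt ha'))

theorem count_rowWord_eq (a : ℕ) : (rowWord lam t r).count a =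
    (if a ∈ rowExtra lam t r then 1 else 0) +
      ((Finset.range (lam r)).filter fun y => boxMin t r y = a).card := by
  rw [rowWord, List.count_append, count_sort, count_map_range]

theorem IsSVT.count_rowWord (ht : IsSVT n lam t) (a : ℕ) :
    (rowWord lam t r).count a = rowCount t a r (Finset.range (lam r)) := by
  rw [count_rowWord_eq, rowCount]
  split_ifs with h
  · obtain ⟨c, hc, hac, hlt⟩ := mem_rowExtra.1 h
    have : (Finset.range (lam r)).filter (fun y => a ∈ t r y) =
        insert c ((Finset.range (lam r)).filter fun y => boxMin t r y = a) := by
      ext y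
      simp only [Finset.mem_filter, Finset.mem_range, Finset.mem_insert]
      constructor
      · rintro ⟨hy, ha⟩
        rcases lt_trichotomy y c with h' | h' | h'
        · have := ht.le_boxMin ha h' hc
          omega
        · exact .inl h'
        · exact .inr ⟨hy, ht.boxMin_eq_of_le hac h' ha⟩
      · rintro (rfl | ⟨hy, rfl⟩)
        · exact ⟨hc, hac⟩
        · exact ⟨hy, ht.boxMin_mem' hy⟩
    rw [this, Finset.card_insert_of_notMem (by simp [hlt.ne]), add_comm]
  · rw [zero_add]
    congr 1
    ext y
    simp only [Finset.mem_filter, Finset.mem_range]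
    refine and_congr_right fun hy => ⟨fun h' => h' ▸ ht.boxMin_mem' hy, fun h' => ?_⟩
    by_contra hne
    exact h (mem_rowExtra.2 ⟨y, hy, h', lt_of_le_of_ne (boxMin_le h') hne⟩)

theorem IsSVT.rowWord_suffix (ht : IsSVT n lam t) {u v : List ℕ}
    (h : rowWord lam t r = u ++ (i + 1) :: v) :
    ∃ x, i + 1 ∈ t r x ∧ ∀ c, (∀ y, c ≤ y → i + 1 ∉ t r y) →
      v.count (i + 1) + 1 ≤ rowCount t (i + 1) r (Finset.Ico x c) ∧
        rowCount t i r (Finset.Ico x c) ≤ v.count i := by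
  have hcount := ht.count_rowWord (r := r) i
  rw [h] at hcount
  rcases append_eq_append_cons h with ⟨v', h1, rfl⟩ | ⟨u', rfl, h1⟩
  · obtain ⟨hu, hv⟩ := sort_eq_append_cons h1
    obtain ⟨x, hx, hmem, hlt⟩ := mem_rowExtra.1
      ((Finset.mem_sort (r := (· ≥ ·)) (a := i + 1)).1 (by rw [h1]; simp))
    refine ⟨x, hmem, fun c hc => ⟨?_, ?_⟩⟩
    · have hv' : i + 1 ∉ v' := fun h' => (hv _ h').false
      rw [List.count_append, List.count_eq_zero_of_not_mem hv', count_map_range, zero_add,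
        ← Finset.card_insert_of_notMem (a := x) (by simp [hlt.ne])]
      refine Finset.card_le_card fun y hy => ?_
      simp only [Finset.mem_insert, Finset.mem_filter, Finset.mem_range, Finset.mem_Ico] at hy ⊢
      rcases hy with rfl | ⟨hy, hy'⟩
      · exact ⟨⟨le_rfl, not_le.1 fun h' => hc _ h' hmem⟩, hmem⟩
      · have hm := ht.boxMin_mem' hy
        rw [hy'] at hm
        refine ⟨⟨not_lt.1 fun hyx => ?_, not_le.1 fun h' => hc _ h' hm⟩, hm⟩
        have := ht.le_boxMin hm hyx hx
        omega
    · have hu' : i ∉ u := fun h' => by have := hu _ h'; omega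
      rw [List.count_append, List.count_eq_zero_of_not_mem hu', zero_add,
        List.count_cons_of_ne (by omega)] at hcount
      rw [hcount]
      exact rowCount_mono fun y _ hy => Finset.mem_range.2 (ht.col_lt hy)
  · obtain ⟨x, hx, hmin, -, rfl⟩ := map_range_eq_append_cons h1
    have hmem := ht.boxMin_mem' hx
    rw [hmin] at hmem
    refine ⟨x, hmem, fun c hc => ⟨?_, ?_⟩⟩
    · rw [count_map_range', show x + 1 + (lam r - (x + 1)) = lam r by omega,
        ← Finset.card_insert_of_notMem (a := x) (by simp)]
      refine Finset.card_le_card fun y hy => ?_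
      simp only [Finset.mem_insert, Finset.mem_filter, Finset.mem_Ico] at hy ⊢
      rcases hy with rfl | ⟨hy, hy'⟩
      · exact ⟨⟨le_rfl, not_le.1 fun h' => hc _ h' hmem⟩, hmem⟩
      · have hm := ht.boxMin_mem' hy.2
        rw [hy'] at hm
        exact ⟨⟨by omega, not_le.1 fun h' => hc _ h' hm⟩, hm⟩
    · refine le_of_eq_of_le (rowCount_eq_zero.2 fun y hy hi => ?_) (Nat.zero_le _)
      rw [Finset.mem_Ico] at hy
      rcases hy.1.eq_or_lt with rfl | hxy
      · have := boxMin_le hi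
        omega
      · have := ht.row_le hxy hmem hi
        omega

theorem IsSVT.rowWord_prefix (ht : IsSVT n lam t) {u v : List ℕ}
    (h : rowWord lam t r = u ++ i :: v) :
    ∃ x, i ∈ t r x ∧ ∀ c, (∀ y, y < c → i ∉ t r y) →
      u.count i + 1 ≤ rowCount t i r (Finset.Ico c (x + 1)) ∧
        rowCount t (i + 1) r (Finset.Ico c (x + 1)) ≤ u.count (i + 1) := by
  have key : ∀ x c, i ∈ t r x → rowCount t (i + 1) r (Finset.Ico c (x + 1)) ≤
      if i + 1 ∈ t r x then 1 else 0 := by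
    intro x c hx
    have : ∀ y ∈ Finset.Ico c (x + 1), i + 1 ∈ t r y → y = x := by
      intro y hy hi
      rw [Finset.mem_Ico] at hy
      by_contra hne
      have := ht.row_le (by omega : y < x) hi hx
      omega
    split_ifs with h'
    · refine Finset.card_le_one.2 fun y hy z hz => ?_
      rw [Finset.mem_filter] at hy hz
      rw [this y hy.1 hy.2, this z hz.1 hz.2]
    · refine (rowCount_eq_zero.2 fun y hy hi => ?_).le
      exact h' (this y hy hi ▸ hi)
  rcases append_eq_append_cons h with ⟨v', h1, rfl⟩ | ⟨u', rfl, h1⟩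
  · obtain ⟨hu, hv⟩ := sort_eq_append_cons h1
    obtain ⟨x, hx, hmem, hlt⟩ := mem_rowExtra.1
      ((Finset.mem_sort (r := (· ≥ ·)) (a := i)).1 (by rw [h1]; simp))
    refine ⟨x, hmem, fun c hc => ⟨?_, (key x c hmem).trans ?_⟩⟩
    · have hu' : i ∉ u := fun h' => (hu _ h').false
      rw [List.count_eq_zero_of_not_mem hu']
      refine Finset.card_pos.2 ⟨x, ?_⟩
      simp only [Finset.mem_filter, Finset.mem_Ico]
      exact ⟨⟨not_lt.1 fun h' => hc x h' hmem, by omega⟩, hmem⟩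
    · split_ifs with h'
      · have hN : i + 1 ∈ rowExtra lam t r := mem_rowExtra.2 ⟨x, hx, h', by omega⟩
        rw [← Finset.mem_sort (r := (· ≥ ·)), h1, List.mem_append, List.mem_cons] at hN
        refine List.count_pos_iff.2 ?_
        rcases hN with hN | hN | hN
        · exact hN
        · omega
        · have := hv _ hN
          omega
      · exact Nat.zero_le _
  · obtain ⟨x, hx, hmin, rfl, -⟩ := map_range_eq_append_cons h1
    have hmem := ht.boxMin_mem' hx
    rw [hmin] at hmem
    refine ⟨x, hmem, fun c hc => ⟨?_, (key x c hmem).trans ?_⟩⟩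
    · rw [List.count_append, count_sort, count_map_range]
      have hsub : insert x ((Finset.range x).filter fun y => boxMin t r y = i) ⊆
          (Finset.Ico c (x + 1)).filter fun y => i ∈ t r y := by
        intro y hy
        simp only [Finset.mem_insert, Finset.mem_filter, Finset.mem_range, Finset.mem_Ico] at hy ⊢
        have hm : i ∈ t r y := by
          rcases hy with rfl | ⟨hy, hy'⟩
          · exact hmem
          · exact hy' ▸ ht.boxMin_mem' (by omega)
        exact ⟨⟨not_lt.1 fun h' => hc y h' hm, by omega⟩, hm⟩
      have hcard := Finset.card_insert_of_notMem (a := x)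
        (s := (Finset.range x).filter fun y => boxMin t r y = i) (by simp)
      split_ifs with h'
      · obtain ⟨z, hz, hiz, hlt⟩ := mem_rowExtra.1 h'
        have hzx : z < x := by
          rcases lt_trichotomy z x with h2 | rfl | h2
          · exact h2
          · omega
          · have := ht.le_boxMin hmem h2 hz
            omega
        have hn : z ∉ insert x ((Finset.range x).filter fun y => boxMin t r y = i) := by
          simp [hzx.ne, hlt.ne]
        have hsub' := Finset.insert_subset (a := z) (by
          simp only [Finset.mem_filter, Finset.mem_Ico]
          exact ⟨⟨not_lt.1 fun h' => hc z h' hiz, by omega⟩, hiz⟩) hsub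
        have := Finset.card_le_card hsub'
        rw [Finset.card_insert_of_notMem hn] at this
        rw [rowCount]
        omega
      · have := Finset.card_le_card hsub
        rw [rowCount]
        omega
    · rw [List.count_append, count_sort]
      split_ifs with h1 h2 h2
      · omega
      · exact absurd (mem_rowExtra.2 ⟨x, hx, h1, by omega⟩) h2
      · omega
      · omega

/-! ### The reading word of a tableau -/

theorem rowsWord_add (a d e : ℕ) :
    rowsWord lam t a (d + e) = rowsWord lam t (a + d) e ++ rowsWord lam t a d := by
  induction e with
  | zero => rfl
  | succ e ih => rw [← add_assoc, rowsWord, ih, rowsWord, List.append_assoc, add_assoc]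

theorem IsSVT.count_rowsWord (ht : IsSVT n lam t) (b a d : ℕ) :
    (rowsWord lam t a d).count b =
      ∑ k ∈ Finset.Ico a (a + d), rowCount t b k (Finset.range (lam k)) := by
  induction d with
  | zero => simp [rowsWord]
  | succ d ih =>
    rw [rowsWord, List.count_append, ih, ht.count_rowWord, ← add_assoc,
      Finset.sum_Ico_succ_top (by omega), add_comm]

theorem rowsWord_eq_append_cons {a d p : ℕ} {u v : List ℕ}
    (h : rowsWord lam t a d = u ++ p :: v) :
    ∃ e < d, ∃ u' v', rowWord lam t (a + e) = u' ++ p :: v' ∧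
      u = rowsWord lam t (a + e + 1) (d - e - 1) ++ u' ∧ v = v' ++ rowsWord lam t a e := by
  induction d generalizing u v with
  | zero => simp [rowsWord] at h
  | succ d ih =>
    rw [rowsWord] at h
    rcases append_eq_append_cons h with ⟨v', h1, rfl⟩ | ⟨u', rfl, h1⟩
    · exact ⟨d, Nat.lt_succ_self d, u, v', h1, by simp [rowsWord], rfl⟩
    · obtain ⟨e, he, u'', v'', h2, rfl, rfl⟩ := ih h1
      refine ⟨e, by omega, u'', v'', h2, ?_, rfl⟩
      rw [show d + 1 - e - 1 = d - e - 1 + 1 by omega, rowsWord,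
        show a + e + 1 + (d - e - 1) = a + d by omega, List.append_assoc]

theorem IsSVT.wordEps_rowsWord_le (ht : IsSVT n lam t) (hl : IsPartitionShape n lam)
    {i q r₀ c : ℕ} (hno : ∀ k y, r₀ ≤ k → c ≤ y → i + 1 ∉ t k y)
    (hq : ∀ x ≤ c, -(q : ℤ) ≤
      ∑ k ∈ Finset.Ico r₀ n, ∑ y ∈ Finset.Ico x c, boxVal t i k y) :
    wordEps i (rowsWord lam t r₀ (n - r₀)) ≤ q := by
  refine wordEps_le i q _ fun s₁ s₂ hs => ?_
  obtain ⟨e, he, u, v, h1, -, rfl⟩ := rowsWord_eq_append_cons hs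
  obtain ⟨x, hx, hxc⟩ := ht.rowWord_suffix h1
  obtain ⟨h2, h3⟩ := hxc c (fun y hy => hno _ y (by omega) hy)
  have hlt : x < c := not_le.1 fun h => hno _ x (by omega) h hx
  have hq := hq x hlt.le
  simp only [sum_boxVal] at hq
  rw [← Finset.sum_Ico_consecutive _ (by omega : r₀ ≤ r₀ + e) (by omega : r₀ + e ≤ n),
    Finset.sum_eq_sum_Ico_succ_bot (by omega : r₀ + e < n)] at hq
  have h4 : ∑ k ∈ Finset.Ico (r₀ + e + 1) n, ((rowCount t i k (Finset.Ico x c) : ℤ) -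
      rowCount t (i + 1) k (Finset.Ico x c)) ≤ 0 := by
    refine Finset.sum_nonpos fun k hk => ?_
    rw [Finset.mem_Ico] at hk
    have : rowCount t i k (Finset.Ico x c) = 0 := rowCount_eq_zero.2 fun y hy hi => by
      have := ht.mono hl hx hi (by omega) (Finset.mem_Ico.1 hy).1 (by omega)
      omega
    omega
  have h5 : ∑ k ∈ Finset.Ico r₀ (r₀ + e), ((rowCount t i k (Finset.Ico x c) : ℤ) -
      rowCount t (i + 1) k (Finset.Ico x c)) ≤ (rowsWord lam t r₀ e).count i -
        (rowsWord lam t r₀ e).count (i + 1) := by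
    rw [ht.count_rowsWord, ht.count_rowsWord]
    push_cast
    rw [← Finset.sum_sub_distrib]
    refine Finset.sum_le_sum fun k hk => ?_
    rw [Finset.mem_Ico] at hk
    have e1 : rowCount t i k (Finset.Ico x c) ≤ rowCount t i k (Finset.range (lam k)) :=
      rowCount_mono fun y _ hy => Finset.mem_range.2 (ht.col_lt hy)
    have e2 : rowCount t (i + 1) k (Finset.range (lam k)) ≤
        rowCount t (i + 1) k (Finset.Ico x c) := rowCount_mono fun y _ hy => by
      refine Finset.mem_Ico.2 ⟨not_lt.1 fun hyx => ?_, not_le.1 fun h => hno _ y hk.1 h hy⟩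
      have := ht.mono hl hy hx (by omega) hyx.le (by omega)
      omega
    omega
  rw [List.count_append, List.count_append]
  omega

theorem IsSVT.wordPhi_rowsWord_le (ht : IsSVT n lam t) (hl : IsPartitionShape n lam)
    {i q r₀ c : ℕ} (hno : ∀ k y, k < r₀ → y < c → i ∉ t k y)
    (hq : ∀ x, c ≤ x → x ≤ lam 0 →
      ∑ k ∈ Finset.range r₀, ∑ y ∈ Finset.Ico c x, boxVal t i k y ≤ q) :
    wordPhi i (rowsWord lam t 0 r₀) ≤ q := by
  refine wordPhi_le i q _ fun s₁ s₂ hs => ?_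
  obtain ⟨e, he, u, v, h1, rfl, -⟩ := rowsWord_eq_append_cons hs
  rw [zero_add] at h1
  obtain ⟨x, hx, hxc⟩ := ht.rowWord_prefix h1
  obtain ⟨h2, h3⟩ := hxc c (fun y hy => hno _ y he hy)
  have hle : c ≤ x := not_lt.1 fun h => hno _ x he h hx
  have hq := hq (x + 1) (by omega) ((ht.col_lt hx).trans_le (hl.antitone (Nat.zero_le _)))
  simp only [sum_boxVal] at hq
  rw [Finset.range_eq_Ico, ← Finset.sum_Ico_consecutive _ (Nat.zero_le e) he.le,
    Finset.sum_eq_sum_Ico_succ_bot he] at hq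
  have h4 : 0 ≤ ∑ k ∈ Finset.Ico 0 e, ((rowCount t i k (Finset.Ico c (x + 1)) : ℤ) -
      rowCount t (i + 1) k (Finset.Ico c (x + 1))) := by
    refine Finset.sum_nonneg fun k hk => ?_
    rw [Finset.mem_Ico] at hk
    have : rowCount t (i + 1) k (Finset.Ico c (x + 1)) = 0 := rowCount_eq_zero.2 fun y hy hi => by
      have := ht.mono hl hi hx (by omega) (Nat.le_of_lt_succ (Finset.mem_Ico.1 hy).2) (by omega)
      omega
    omega
  have h5 : ((rowsWord lam t (0 + e + 1) (r₀ - e - 1)).count i : ℤ) -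
        (rowsWord lam t (0 + e + 1) (r₀ - e - 1)).count (i + 1) ≤
      ∑ k ∈ Finset.Ico (e + 1) r₀, ((rowCount t i k (Finset.Ico c (x + 1)) : ℤ) -
      rowCount t (i + 1) k (Finset.Ico c (x + 1))) := by
    rw [ht.count_rowsWord, ht.count_rowsWord, show 0 + e + 1 + (r₀ - e - 1) = r₀ by omega, zero_add]
    push_cast
    rw [← Finset.sum_sub_distrib]
    refine Finset.sum_le_sum fun k hk => ?_
    rw [Finset.mem_Ico] at hk
    have e1 : rowCount t (i + 1) k (Finset.Ico c (x + 1)) ≤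
        rowCount t (i + 1) k (Finset.range (lam k)) :=
      rowCount_mono fun y _ hy => Finset.mem_range.2 (ht.col_lt hy)
    have e2 : rowCount t i k (Finset.range (lam k)) ≤
        rowCount t i k (Finset.Ico c (x + 1)) := rowCount_mono fun y _ hy => by
      refine Finset.mem_Ico.2 ⟨not_lt.1 fun h => hno _ y hk.2 h hy, not_le.1 fun hxy => ?_⟩
      have := ht.mono hl hx hy (by omega) (by omega) (by omega)
      omega
    omega
  rw [List.count_append, List.count_append]
  omega

end

theorem sort_insert_erase {S : Finset ℕ} {u v : List ℕ} {p p' : ℕ}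
    (h : S.sort (· ≥ ·) = u ++ p :: v) (hp : p ≤ p') (hu : ∀ a ∈ u, p' < a) :
    (insert p' (S.erase p)).sort (· ≥ ·) = u ++ p' :: v := by
  have hs := (List.sortedGT_iff_pairwise).1 (Finset.sortedGT_sort S)
  obtain ⟨hu', hv⟩ := sort_eq_append_cons h
  have hmem : ∀ a, a ∈ S ↔ a ∈ u ∨ a = p ∨ a ∈ v := fun a => by
    rw [← Finset.mem_sort (r := (· ≥ ·)), h]; simp
  rw [h, List.pairwise_append, List.pairwise_cons] at hs
  have hpw : (u ++ p' :: v).Pairwise (· > ·) := by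
    rw [List.pairwise_append, List.pairwise_cons]
    refine ⟨hs.1, ⟨fun a ha => (hv a ha).trans_le hp, hs.2.1.2⟩, fun a ha b hb => ?_⟩
    rcases List.mem_cons.1 hb with rfl | hb
    · exact hu a ha
    · exact hs.2.2 a ha b (List.mem_cons_of_mem _ hb)
  have e : insert p' (S.erase p) = (u ++ p' :: v).toFinset := by
    ext a
    simp only [Finset.mem_insert, Finset.mem_erase, hmem, List.mem_toFinset, List.mem_append,
      List.mem_cons]
    constructor
    · tauto
    · rintro (h | h | h)
      · exact .inr ⟨(hu' a h).ne', .inl h⟩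
      · exact .inl h
      · exact .inr ⟨(hv a h).ne, .inr (.inr h)⟩
  rw [e]
  exact (List.toFinset_sort (r := (· ≥ ·)) (hpw.imp fun h => h.ne')).2 (hpw.imp fun h => h.le)

section

variable {n : ℕ} {lam : ℕ → ℕ} {t : Filling} {r c i : ℕ}

theorem rowWord_eq_append_cons {m : ℕ} (hm : m < lam r) :
    rowWord lam t r = ((rowExtra lam t r).sort (· ≥ ·) ++ (List.range m).map (boxMin t r)) ++
      boxMin t r m :: (List.range' (m + 1) (lam r - (m + 1))).map (boxMin t r) := by
  rw [rowWord, range_split hm, List.map_append, List.map_cons, List.append_assoc]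

/-- A row word changes by one letter when one box minimum changes. -/
theorem rowWord_eq_of_boxMin {t' : Filling} {m : ℕ} (hm : m < lam r)
    (hE : rowExtra lam t' r = rowExtra lam t r)
    (hB : ∀ y, y ≠ m → boxMin t' r y = boxMin t r y) :
    rowWord lam t' r = ((rowExtra lam t r).sort (· ≥ ·) ++ (List.range m).map (boxMin t r)) ++
      boxMin t' r m :: (List.range' (m + 1) (lam r - (m + 1))).map (boxMin t r) := by
  rw [rowWord_eq_append_cons hm, hE]
  congr 2
  · refine List.map_congr_left fun y hy => hB y ?_
    rw [List.mem_range] at hy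
    omega
  · refine List.map_congr_left fun y hy => hB y ?_
    rw [List.mem_range'_1] at hy
    omega

/-- The effect of `f_i` on the reading word of the row on which it acts. -/
def RowStep (lam : ℕ → ℕ) (i : ℕ) (t t' : Filling) (r c : ℕ) : Prop :=
  ∃ P Q, rowWord lam t r = P ++ i :: Q ∧ rowWord lam t' r = P ++ (i + 1) :: Q ∧
    wordEps i P = 0 ∧ wordPhi i Q = 0 ∧ rowCount t i r (Finset.range c) ≤ wordPhi i P ∧
    ∀ x, rowCount t (i + 1) r (Finset.Ico (c + 1) x) ≤
      wordEps i Q + rowCount t i r (Finset.Ico (c + 1) x)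

theorem IsSVT.le_wordEps_add (ht : IsSVT n lam t) (hr : i ∈ t r c) {m : ℕ} {Q' Q : List ℕ}
    (hm : ∀ y, c < y → y < m → boxMin t r y ≠ i + 1)
    (hQ : Q = Q' ++ (List.range' m (lam r - m)).map (boxMin t r)) (hi : i ∉ Q) (x : ℕ) :
    rowCount t (i + 1) r (Finset.Ico (c + 1) x) ≤
      wordEps i Q + rowCount t i r (Finset.Ico (c + 1) x) := by
  have h1 := wordPhi_add_count i Q
  rw [wordPhi_eq_zero_of_notMem hi, List.count_eq_zero_of_not_mem hi] at h1
  have h2 : ((Finset.Ico m (lam r)).filter fun y => boxMin t r y = i + 1).card ≤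
      Q.count (i + 1) := by
    rw [hQ, List.count_append, count_map_range']
    refine le_trans (Finset.card_le_card fun y => ?_) (Nat.le_add_left _ _)
    simp only [Finset.mem_filter, Finset.mem_Ico]
    omega
  have h3 : rowCount t (i + 1) r (Finset.Ico (c + 1) x) ≤
      ((Finset.Ico m (lam r)).filter fun y => boxMin t r y = i + 1).card +
        rowCount t i r (Finset.Ico (c + 1) x) := by
    refine le_trans (Finset.card_le_card fun y hy => ?_) (Finset.card_union_le _ _)
    simp only [Finset.mem_filter, Finset.mem_Ico, Finset.mem_union] at hy ⊢
    have hlt := ht.col_lt hy.2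
    have := ht.le_boxMin hr (by omega : c < y) hlt
    have := boxMin_le hy.2
    rcases (by omega : boxMin t r y = i + 1 ∨ boxMin t r y = i) with h | h
    · exact .inl ⟨⟨not_lt.1 fun hy' => hm y (by omega) hy' h, hlt⟩, h⟩
    · exact .inr ⟨hy.1, h ▸ ht.boxMin_mem' hlt⟩
  omega

theorem IsSVT.rowStep_fTarget (ht : IsSVT n lam t) (hl : IsPartitionShape n lam)
    (hc : fBoxCol n (lam 0) t i c) (hr : i ∈ t r c) :
    RowStep lam i t (SVTCrystal.fTarget i t r c) r c := by
  have hno := ht.notMem_of_fBoxCol hl hc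
  have hcl := ht.col_lt hr
  have hLle : ∀ y a, y < c → a ∈ t r y → a ≤ i := fun y a hy ha => ht.row_le hy ha hr
  have hRle : ∀ y a, c < y → a ∈ t r y → i ≤ a := fun y a hy ha => ht.row_le hy hr ha
  have hcount := ht.count_rowWord (r := r) i
  have hins : rowCount t i r (Finset.range c) + 1 ≤ rowCount t i r (Finset.range (c + 1)) := by
    rw [rowCount, rowCount, Finset.range_add_one, Finset.filter_insert, if_pos hr,
      Finset.card_insert_of_notMem (by simp)]
  rcases fCol_eq i t r c with ⟨hf, hnext⟩ | ⟨hf, hnext⟩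
  · have hRi : ∀ y, c < y → i ∉ t r y := by
      intro y hy hi
      rcases (Nat.succ_le_of_lt hy).eq_or_lt with rfl | hlt
      · exact hnext hi
      · have h1 : c + 1 < lam r := by have := ht.col_lt hi; omega
        have hm := ht.boxMin_mem' h1
        have := ht.row_le hlt hm hi
        have := hRle _ _ (Nat.lt_succ_self c) hm
        exact hnext (by rwa [show boxMin t r (c + 1) = i by omega] at hm)
    have hEno : i + 1 ∉ rowExtra lam t r := by
      intro h
      obtain ⟨y, hy, hmem, hlt⟩ := mem_rowExtra.1 h
      rcases lt_trichotomy y c with h' | rfl | h'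
      · have := hLle y _ h' hmem
        omega
      · exact hno _ hmem
      · have hm := ht.boxMin_mem' hy
        have := hRle y _ h' hm
        exact hRi y h' (by rwa [show boxMin t r y = i by omega] at hm)
    have hmem' : ∀ a y, a ∈ SVTCrystal.fTarget i t r c r y ↔
        (a ∈ t r y ∧ ¬ (y = c ∧ a = i)) ∨ (y = c ∧ a = i + 1) := fun a y => by
      rw [mem_fTarget, hf]; simp
    have hB : ∀ y, y ≠ c → boxMin (SVTCrystal.fTarget i t r c) r y = boxMin t r y := by
      intro y hy
      have : SVTCrystal.fTarget i t r c r y = t r y := by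
        ext a; rw [hmem']; simp [hy]
      rw [boxMin, boxMin, this]
    by_cases hmin : boxMin t r c = i
    · have hBc : boxMin (SVTCrystal.fTarget i t r c) r c = i + 1 := by
        refine boxMin_eq ((hmem' _ _).2 (.inr ⟨rfl, rfl⟩)) fun b hb => ?_
        rcases (hmem' _ _).1 hb with h | h
        · have := boxMin_le h.1
          omega
        · omega
      have hE : rowExtra lam (SVTCrystal.fTarget i t r c) r = rowExtra lam t r := by
        ext a
        rw [mem_rowExtra, mem_rowExtra]
        refine exists_congr fun y => and_congr_right fun _ => ?_
        rw [hmem']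
        by_cases hy : y = c
        · subst hy
          rw [hBc, hmin]
          constructor
          · rintro ⟨h | h, h'⟩
            · exact ⟨h.1, by omega⟩
            · omega
          · rintro ⟨h, h'⟩
            have : a ≠ i + 1 := fun e => hno _ (e ▸ h)
            exact ⟨.inl ⟨h, by omega⟩, by omega⟩
        · rw [hB y hy]
          simp [hy]
      have e1 := rowWord_eq_append_cons (t := t) hcl
      have e2 := rowWord_eq_of_boxMin hcl hE hB
      rw [hmin] at e1
      rw [hBc] at e2
      refine ⟨_, _, e1, e2, ?_⟩
      set P := (rowExtra lam t r).sort (· ≥ ·) ++ (List.range c).map (boxMin t r) with hP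
      set Q := (List.range' (c + 1) (lam r - (c + 1))).map (boxMin t r) with hQ
      have hiQ : i ∉ Q := by
        intro h
        obtain ⟨y, hy, hy'⟩ := List.mem_map.1 h
        rw [List.mem_range'_1] at hy
        exact hRi y (by omega) (hy' ▸ ht.boxMin_mem' (by omega))
      have hiP : i + 1 ∉ P := by
        intro h
        rcases List.mem_append.1 h with h | h
        · exact hEno ((Finset.mem_sort _).1 h)
        · obtain ⟨y, hy, hy'⟩ := List.mem_map.1 h
          rw [List.mem_range] at hy
          have := hLle y _ hy (ht.boxMin_mem' (by omega))
          omega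
      refine ⟨wordEps_eq_zero_of_notMem hiP, wordPhi_eq_zero_of_notMem hiQ, ?_,
        ht.le_wordEps_add hr (Q' := []) (m := c + 1) (fun y h1 h2 => by omega)
          (by simp [hQ]) hiQ⟩
      · have h1 := wordPhi_add_count i P
        rw [wordEps_eq_zero_of_notMem hiP, List.count_eq_zero_of_not_mem hiP] at h1
        rw [e1, List.count_append, List.count_cons_self, List.count_eq_zero_of_not_mem hiQ]
          at hcount
        have : rowCount t i r (Finset.range (c + 1)) ≤ rowCount t i r (Finset.range (lam r)) :=
          rowCount_mono fun y _ hy => Finset.mem_range.2 (ht.col_lt hy)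
        omega
    · have hminc := lt_of_le_of_ne (boxMin_le hr) hmin
      have hB' : ∀ y, boxMin (SVTCrystal.fTarget i t r c) r y = boxMin t r y := by
        intro y
        by_cases hy : y = c
        · subst hy
          refine boxMin_eq ((hmem' _ _).2 (.inl ⟨ht.boxMin_mem' hcl, fun h => hmin h.2⟩))
            fun b hb => ?_
          rcases (hmem' _ _).1 hb with h | h
          · exact boxMin_le h.1
          · omega
        · exact hB y hy
      have hE : rowExtra lam (SVTCrystal.fTarget i t r c) r =
          insert (i + 1) ((rowExtra lam t r).erase i) := by
        ext a
        rw [Finset.mem_insert, Finset.mem_erase, mem_rowExtra, mem_rowExtra]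
        simp only [hmem', hB']
        constructor
        · rintro ⟨y, hy, ⟨h1, h2⟩ | h1, h3⟩
          · refine .inr ⟨?_, y, hy, h1, h3⟩
            rintro rfl
            rcases lt_trichotomy y c with h' | h' | h'
            · have := ht.le_boxMin h1 h' hcl
              omega
            · exact h2 ⟨h', rfl⟩
            · exact hRi y h' h1
          · exact .inl h1.2
        · rintro (h | ⟨h, y, hy, h1, h2⟩)
          · exact ⟨c, hcl, .inr ⟨rfl, h⟩, by omega⟩
          · exact ⟨y, hy, .inl ⟨h1, fun h' => h h'.2⟩, h2⟩
      obtain ⟨A, B, hAB⟩ := List.append_of_mem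
        ((Finset.mem_sort (r := (· ≥ ·))).2 (mem_rowExtra.2 ⟨c, hcl, hr, hminc⟩))
      obtain ⟨hA, hB1⟩ := sort_eq_append_cons hAB
      have hiA : i + 1 ∉ A := fun h => hEno
        ((Finset.mem_sort (r := (· ≥ ·))).1 (by rw [hAB]; exact List.mem_append_left _ h))
      have hiQ : i ∉ B ++ (List.range (lam r)).map (boxMin t r) := by
        intro h
        rcases List.mem_append.1 h with h | h
        · exact (hB1 _ h).false
        · obtain ⟨y, hy, hy'⟩ := List.mem_map.1 h
          rw [List.mem_range] at hy
          have hm := ht.boxMin_mem' hy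
          rw [hy'] at hm
          rcases lt_trichotomy y c with h' | h' | h'
          · have := ht.le_boxMin hm h' hcl
            omega
          · rw [h'] at hy'
            exact hmin hy'
          · exact hRi y h' hm
      refine ⟨A, B ++ (List.range (lam r)).map (boxMin t r), ?_, ?_,
        wordEps_eq_zero_of_notMem hiA, wordPhi_eq_zero_of_notMem hiQ, ?_, fun x => ?_⟩
      · rw [rowWord, hAB]
        simp
      · rw [rowWord, hE, sort_insert_erase hAB (Nat.le_succ i) fun a ha => ?_,
          List.map_congr_left fun y _ => hB' y]
        · simp
        · exact lt_of_le_of_ne (hA a ha) fun h => hiA (by rw [show i + 1 = a from h]; exact ha)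
      · refine le_of_eq_of_le (rowCount_eq_zero.2 fun y hy hi => ?_) (Nat.zero_le _)
        have := ht.le_boxMin hi (Finset.mem_range.1 hy) hcl
        omega
      · refine ht.le_wordEps_add hr (m := 0) (Q' := B) (fun y _ h => absurd h (Nat.not_lt_zero y)) ?_ hiQ x
        rw [List.range_eq_range']
        rfl
  · have hsucc := ht.succ_mem_of_fBoxCol hl hc hr hnext
    have hcl' := ht.col_lt hnext
    have hmin1 : boxMin t r (c + 1) = i := ht.boxMin_eq_of_le hr (Nat.lt_succ_self c) hnext
    have hminc := boxMin_le hr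
    have hmem' : ∀ a y, a ∈ SVTCrystal.fTarget i t r c r y ↔
        (a ∈ t r y ∧ ¬ (y = c + 1 ∧ a = i)) ∨ (y = c ∧ a = i + 1) := fun a y => by
      rw [mem_fTarget, hf]; simp
    have hB : ∀ y, y ≠ c + 1 → boxMin (SVTCrystal.fTarget i t r c) r y = boxMin t r y := by
      intro y hy
      by_cases hyc : y = c
      · subst hyc
        refine boxMin_eq ((hmem' _ _).2 (.inl ⟨ht.boxMin_mem' hcl, fun h => hy h.1⟩))
          fun b hb => ?_
        rcases (hmem' _ _).1 hb with h | h
        · exact boxMin_le h.1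
        · omega
      · have : SVTCrystal.fTarget i t r c r y = t r y := by
          ext a; rw [hmem']; simp [hy, hyc]
        rw [boxMin, boxMin, this]
    have hB1 : boxMin (SVTCrystal.fTarget i t r c) r (c + 1) = i + 1 := by
      refine boxMin_eq ((hmem' _ _).2 (.inl ⟨hsucc, by omega⟩)) fun b hb => ?_
      rcases (hmem' _ _).1 hb with h | h
      · have := boxMin_le h.1
        omega
      · omega
    have hE : rowExtra lam (SVTCrystal.fTarget i t r c) r = rowExtra lam t r := by
      ext a
      rw [mem_rowExtra, mem_rowExtra]
      constructor
      · rintro ⟨y, hy, h, h'⟩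
        rcases (hmem' _ _).1 h with h | ⟨rfl, rfl⟩
        · refine ⟨y, hy, h.1, ?_⟩
          by_cases hyc : y = c + 1
          · subst hyc
            omega
          · rwa [hB y hyc] at h'
        · exact ⟨y + 1, hcl', hsucc, by omega⟩
      · rintro ⟨y, hy, h, h'⟩
        by_cases hyc : y = c + 1
        · subst hyc
          by_cases ha : a = i + 1
          · refine ⟨c, hcl, (hmem' _ _).2 (.inr ⟨rfl, ha⟩), ?_⟩
            rw [hB c (by omega)]
            omega
          · exact ⟨c + 1, hcl', (hmem' _ _).2 (.inl ⟨h, by omega⟩), by omega⟩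
        · refine ⟨y, hy, (hmem' _ _).2 (.inl ⟨h, fun e => hyc e.1⟩), ?_⟩
          rwa [hB y hyc]
    have e1 := rowWord_eq_append_cons (t := t) hcl'
    have e2 := rowWord_eq_of_boxMin hcl' hE hB
    rw [hmin1] at e1
    rw [hB1] at e2
    refine ⟨_, _, e1, e2, ?_⟩
    set M := (List.range (c + 1)).map (boxMin t r) with hM
    set P := (rowExtra lam t r).sort (· ≥ ·) ++ M with hP
    set Q := (List.range' (c + 1 + 1) (lam r - (c + 1 + 1))).map (boxMin t r) with hQ
    have hiQ : i ∉ Q := by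
      intro h
      obtain ⟨y, hy, hy'⟩ := List.mem_map.1 h
      rw [List.mem_range'_1] at hy
      have := ht.le_boxMin hsucc (by omega : c + 1 < y) (by omega)
      omega
    have hiM : i + 1 ∉ M := by
      intro h
      obtain ⟨y, hy, hy'⟩ := List.mem_map.1 h
      rw [List.mem_range] at hy
      rcases (by omega : y = c ∨ y < c) with rfl | h'
      · omega
      · have := hLle y _ h' (ht.boxMin_mem' (by omega))
        omega
    have heps : wordEps i P = 0 := by
      refine Nat.le_zero.1 (wordEps_le i 0 P fun s₁ s₂ h => ?_)
      rw [hP] at h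
      rcases append_eq_append_cons h with ⟨v, h1, rfl⟩ | ⟨u, rfl, h1⟩
      · obtain ⟨hu, hv⟩ := sort_eq_append_cons h1
        have hv' : i + 1 ∉ v := fun h => (hv _ h).false
        rw [List.count_append, List.count_eq_zero_of_not_mem hv',
          List.count_eq_zero_of_not_mem hiM]
        refine List.count_pos_iff.2 (List.mem_append.2 ?_)
        by_cases hm : boxMin t r c = i
        · exact .inr (List.mem_map.2 ⟨c, List.mem_range.2 (Nat.lt_succ_self c), hm⟩)
        · have : i ∈ (rowExtra lam t r).sort (· ≥ ·) :=
            (Finset.mem_sort _).2 (mem_rowExtra.2 ⟨c, hcl, hr, lt_of_le_of_ne hminc hm⟩)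
          rw [h1, List.mem_append, List.mem_cons] at this
          rcases this with h' | h' | h'
          · have := hu _ h'
            omega
          · omega
          · exact .inl h'
      · exact absurd (h1 ▸ List.mem_append_right _ List.mem_cons_self) hiM
    refine ⟨heps, wordPhi_eq_zero_of_notMem hiQ, ?_,
      ht.le_wordEps_add hr (Q' := []) (m := c + 1 + 1) (fun y h1 h2 => ?_) (by simp [hQ]) hiQ⟩
    · have h1 := wordPhi_add_count i P
      have h2 : P.count (i + 1) ≤ 1 := by
        rw [hP, List.count_append, count_sort, List.count_eq_zero_of_not_mem hiM]
        split_ifs <;> omega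
      rw [heps] at h1
      rw [e1, List.count_append, List.count_cons_self, List.count_eq_zero_of_not_mem hiQ]
        at hcount
      have h3 : rowCount t i r (Finset.range (c + 1)) + 1 ≤
          rowCount t i r (Finset.range (c + 1 + 1)) := by
        rw [rowCount, rowCount, Finset.range_add_one (n := c + 1), Finset.filter_insert,
          if_pos hnext, Finset.card_insert_of_notMem (by simp)]
      have : rowCount t i r (Finset.range (c + 1 + 1)) ≤ rowCount t i r (Finset.range (lam r)) :=
        rowCount_mono fun y _ hy => Finset.mem_range.2 (ht.col_lt hy)
      omega
    · rw [show y = c + 1 by omega, hmin1]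
      omega

end

section

variable {n : ℕ} {lam : ℕ → ℕ} {t t' : Filling} {r c i : ℕ}

theorem IsSVT.signSum_sub (ht : IsSVT n lam t) (hl : IsPartitionShape n lam) (i : ℕ) {x y : ℕ}
    (h : x ≤ y) : signSum n t i y - signSum n t i x =
      ∑ k ∈ Finset.range n, ∑ z ∈ Finset.Ico x y, boxVal t i k z := by
  rw [Finset.sum_comm, signSum, signSum, ← Finset.sum_range_add_sum_Ico _ h, add_sub_cancel_left]
  exact Finset.sum_congr rfl fun z _ => ht.signVal_colSign hl i z

theorem rowWord_congr (h : t r = t' r) : rowWord lam t r = rowWord lam t' r := by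
  have h' : boxMin t r = boxMin t' r := by
    funext c
    rw [boxMin, boxMin, h]
  rw [rowWord, rowWord, rowExtra, rowExtra, h, h']

theorem rowsWord_congr {a d : ℕ} (h : ∀ k, a ≤ k → k < a + d → t k = t' k) :
    rowsWord lam t a d = rowsWord lam t' a d := by
  induction d with
  | zero => rfl
  | succ d ih =>
    rw [rowsWord, rowsWord, ih fun k h1 h2 => h k h1 (by omega),
      rowWord_congr (h (a + d) (by omega) (by omega))]

theorem rowsWord_split {r : ℕ} (hr : r < n) : rowsWord lam t 0 n =
    rowsWord lam t (r + 1) (n - (r + 1)) ++ (rowWord lam t r ++ rowsWord lam t 0 r) := by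
  have h1 := rowsWord_add (lam := lam) (t := t) 0 (r + 1) (n - (r + 1))
  rw [show r + 1 + (n - (r + 1)) = n by omega, zero_add, rowsWord, zero_add] at h1
  exact h1

theorem fTarget_row {k : ℕ} (hk : k ≠ r) : fTarget i t r c k = t k := by
  funext z
  ext a
  rw [mem_fTarget]
  simp [hk]

theorem IsSVT.wordStep_fTarget (ht : IsSVT n lam t) (hl : IsPartitionShape n lam)
    (hc : fBoxCol n (lam 0) t i c) (hrn : r < n) (hr : i ∈ t r c) :
    WordStep i (rowsWord lam t 0 n) (rowsWord lam (SVTCrystal.fTarget i t r c) 0 n) := by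
  obtain ⟨P, Q, h1, h2, hP, hQ, hP', hQ'⟩ := ht.rowStep_fTarget hl hc hr
  have hno := ht.notMem_of_fBoxCol hl hc
  have hsum : ∀ F : ℕ → ℤ, ∑ k ∈ Finset.range n, F k =
      ∑ k ∈ Finset.range r, F k + (F r + ∑ k ∈ Finset.Ico (r + 1) n, F k) := fun F => by
    rw [← Finset.sum_range_add_sum_Ico F hrn, Finset.sum_range_succ, add_assoc]
  obtain ⟨hcN, hS, hSl, hSr⟩ := fBoxCol_iff.1 hc
  have hlow : ∀ k y, r < k → c ≤ y → i + 1 ∉ t k y := by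
    intro k y hk hy h
    rcases hy.eq_or_lt with rfl | hy
    · exact hno _ h
    have := ht.mono hl hr h hk.le hy.le (.inl hy)
    have hy' := ht.col_lt h
    have hlk := hl.antitone hk.le
    have hck : c < lam k := by omega
    obtain ⟨b, hb⟩ := ht.boxNonempty k c hck
    have h3 := ht.mono hl hr hb hk.le le_rfl (.inr hk)
    have h4 := ht.row_le hy hb h
    exact hno k (by rwa [show b = i + 1 by omega] at hb)
  have heps : wordEps i (rowsWord lam t (r + 1) (n - (r + 1))) ≤ wordPhi i P := by
    refine ht.wordEps_rowsWord_le hl (c := c) (fun k y hk hy => hlow k y hk hy) fun x hx => ?_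
    have h3 := ht.signSum_sub hl i hx
    have h4 := hSl x hx
    rw [hsum] at h3
    have h5 : ∑ k ∈ Finset.range r, ∑ z ∈ Finset.Ico x c, boxVal t i k z ≤ 0 := by
      refine Finset.sum_nonpos fun k hk => ?_
      rw [Finset.mem_range] at hk
      rw [sum_boxVal, rowCount_eq_zero.2]
      · simp
      · intro z hz h
        rw [Finset.mem_Ico] at hz
        have := ht.mono hl h hr hk.le hz.2.le (.inr hk)
        omega
    have h6 : ∑ z ∈ Finset.Ico x c, boxVal t i r z ≤ wordPhi i P := by
      have : rowCount t i r (Finset.Ico x c) ≤ rowCount t i r (Finset.range c) :=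
        rowCount_mono fun y hy _ => Finset.mem_range.2 (Finset.mem_Ico.1 hy).2
      rw [sum_boxVal]
      omega
    omega
  have hphi : wordPhi i (rowsWord lam t 0 r) ≤ wordEps i Q := by
    refine ht.wordPhi_rowsWord_le hl (c := c + 1) (fun k y hk hy h => ?_) fun x hx hx' => ?_
    · have := ht.mono hl h hr hk.le (by omega) (.inr hk)
      omega
    · have h3 := ht.signSum_sub hl i hx
      have h4 := hSr x hx hx'
      rw [hsum] at h3
      have h5 : 0 ≤ ∑ k ∈ Finset.Ico (r + 1) n, ∑ z ∈ Finset.Ico (c + 1) x, boxVal t i k z := by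
        refine Finset.sum_nonneg fun k hk => ?_
        rw [Finset.mem_Ico] at hk
        rw [sum_boxVal, rowCount_eq_zero (a := i + 1) |>.2]
        · simp
        · intro z hz h
          rw [Finset.mem_Ico] at hz
          exact hlow k z hk.1 (by omega) h
      have h6 := hQ' x
      rw [sum_boxVal] at h3
      omega
  have hw := word_append i (rowsWord lam t (r + 1) (n - (r + 1))) P
  have hw' := word_append i Q (rowsWord lam t 0 r)
  refine ⟨rowsWord lam t (r + 1) (n - (r + 1)) ++ P, Q ++ rowsWord lam t 0 r, ?_, ?_, ?_, ?_⟩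
  · rw [rowsWord_split hrn, h1]
    simp
  · rw [rowsWord_split hrn, h2,
      rowsWord_congr (t := SVTCrystal.fTarget i t r c) (t' := t) (a := r + 1)
        fun k hk _ => fTarget_row (by omega),
      rowsWord_congr (t := SVTCrystal.fTarget i t r c) (t' := t) (a := 0)
        fun k _ hk => fTarget_row (by omega)]
    simp
  · rw [hw.2]
    omega
  · rw [hw'.1]
    omega

theorem IsSVT.length_rowWord_fTarget (ht : IsSVT n lam t) (hl : IsPartitionShape n lam)
    (hc : fBoxCol n (lam 0) t i c) (hr : i ∈ t r c) (k : ℕ) :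
    (rowWord lam (SVTCrystal.fTarget i t r c) k).length = (rowWord lam t k).length := by
  by_cases hk : k = r
  · subst hk
    obtain ⟨P, Q, h1, h2, -⟩ := ht.rowStep_fTarget hl hc hr
    rw [h1, h2]
    simp
  · rw [rowWord_congr (fTarget_row hk)]

/-- The properties relating two tableaux with `f_i t = t'`. -/
structure IsTableauStep (n : ℕ) (lam : ℕ → ℕ) (i : ℕ) (t t' : Filling) : Prop where
  left : IsSVT n lam t
  right : IsSVT n lam t'
  eq : fRaw n lam i t = some t'
  wordStep : WordStep i (rowsWord lam t 0 n) (rowsWord lam t' 0 n)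
  length : ∀ k, (rowWord lam t' k).length = (rowWord lam t k).length

theorem IsSVT.tableauStep_fRaw (ht : IsSVT n lam t) (hl : IsPartitionShape n lam) (hi : i < n)
    (h : fRaw n lam i t = some t') : IsTableauStep n lam i t t' := by
  obtain ⟨r, c, hc, hrn, hr, rfl⟩ := exists_of_fRaw_eq_some h
  exact ⟨ht, ht.fTarget hl hi hc hr, h, ht.wordStep_fTarget hl hc hrn hr,
    ht.length_rowWord_fTarget hl hc hr⟩

theorem IsSVT.tableauStep_eRaw (ht : IsSVT n lam t) (hl : IsPartitionShape n lam) (hi : 1 ≤ i)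
    (hin : i < n) (h : eRaw n lam i t = some t') : IsTableauStep n lam i t' t := by
  obtain ⟨r, c, hc, hrn, hr, rfl⟩ := exists_of_eRaw_eq_some h
  exact (ht.eTarget hl hi hin hc hr).tableauStep_fRaw hl hin (ht.fRaw_eTarget hl hi hin hc hr)

theorem IsSVT.wordPhi_eq_zero (ht : IsSVT n lam t) (hl : IsPartitionShape n lam)
    (h : fRaw n lam i t = none) : wordPhi i (rowsWord lam t 0 n) = 0 := by
  have h' := fRaw_eq_none_iff.1 h
  refine Nat.le_zero.1 (ht.wordPhi_rowsWord_le hl (c := 0) 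
    (fun _ y _ hy => absurd hy (Nat.not_lt_zero y))
    fun x hx hx' => ?_)
  rw [← ht.signSum_sub hl i hx]
  have := signSum_le_zero_of_forall_not_fBoxCol h' hx'
  simpa [signSum] using this

theorem IsSVT.wordEps_eq_zero (ht : IsSVT n lam t) (hl : IsPartitionShape n lam)
    (h : eRaw n lam i t = none) : wordEps i (rowsWord lam t 0 n) = 0 := by
  have h' := eRaw_eq_none_iff.1 h
  refine Nat.le_zero.1 (ht.wordEps_rowsWord_le hl (r₀ := 0) (c := lam 0) (fun k y _ hy h => ?_)
    fun x hx => ?_)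
  · have := ht.col_lt h
    have := hl.antitone (Nat.zero_le k)
    omega
  · rw [← Finset.range_eq_Ico, ← ht.signSum_sub hl i hx]
    have := signSum_le_of_forall_not_eBoxCol h' hx
    simpa using this

theorem IsSVT.count_rowsWord_eq_wt (ht : IsSVT n lam t) (hl : IsPartitionShape n lam) (a : ℕ) :
    (rowsWord lam t 0 n).count a = wt n lam t a := by
  rw [ht.count_rowsWord, wt, Finset.card_filter, Finset.sum_product, zero_add,
    ← Finset.range_eq_Ico]
  refine Finset.sum_congr rfl fun k _ => ?_
  rw [← Finset.card_filter]
  refine le_antisymm (rowCount_mono fun y hy _ => ?_)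
    (rowCount_mono (I := Finset.range (lam 0)) fun y _ hy => Finset.mem_range.2 (ht.col_lt hy))
  have := hl.antitone (Nat.zero_le k)
  rw [Finset.mem_range] at hy ⊢
  omega

theorem IsSVT.bounds_of_mem_rowsWord (ht : IsSVT n lam t) {a : ℕ}
    (h : a ∈ rowsWord lam t 0 n) : 1 ≤ a ∧ a ≤ n := by
  rw [← List.count_pos_iff, ht.count_rowsWord] at h
  obtain ⟨k, -, hk⟩ := Finset.exists_ne_zero_of_sum_ne_zero h.ne'
  rw [Ne, rowCount_eq_zero] at hk
  push Not at hk
  obtain ⟨y, -, hy⟩ := hk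
  exact ht.entryBounds _ _ _ hy

theorem IsSVT.mem_iff_of_rowWord (ht : IsSVT n lam t) {a : ℕ} (hc : c < lam r) :
    a ∈ t r c ↔ a = boxMin t r c ∨ (a ∈ rowExtra lam t r ∧ boxMin t r c < a ∧
      ∀ y, c < y → y < lam r → a ≤ boxMin t r y) := by
  constructor
  · intro h
    rcases (boxMin_le h).eq_or_lt with h' | h'
    · exact .inl h'.symm
    · exact .inr ⟨mem_rowExtra.2 ⟨c, hc, h, h'⟩, h', fun y hy hy' => ht.le_boxMin h hy hy'⟩
  · rintro (h | ⟨h, h1, h2⟩)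
    · exact h ▸ ht.boxMin_mem' hc
    · obtain ⟨y, hy, hm, hlt⟩ := mem_rowExtra.1 h
      rcases lt_trichotomy y c with h' | rfl | h'
      · have := ht.le_boxMin hm h' hc
        omega
      · exact hm
      · have := h2 y h' hy
        omega

theorem IsSVT.row_eq (ht : IsSVT n lam t) (ht' : IsSVT n lam t')
    (h : rowWord lam t r = rowWord lam t' r) : t r = t' r := by
  have hlen := congrArg List.length h
  rw [rowWord, rowWord, List.length_append, List.length_append, List.length_map,
    List.length_map] at hlen
  obtain ⟨h1, h2⟩ := List.append_inj h (by omega)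
  have hE : rowExtra lam t r = rowExtra lam t' r := by
    ext a
    rw [← Finset.mem_sort (r := (· ≥ ·)), h1, Finset.mem_sort]
  have hB : ∀ c, c < lam r → boxMin t r c = boxMin t' r c := fun c hc =>
    List.map_inj_left.1 h2 c (List.mem_range.2 hc)
  funext c
  by_cases hc : c < lam r
  · ext a
    rw [ht.mem_iff_of_rowWord hc, ht'.mem_iff_of_rowWord hc, hE, hB c hc]
    refine or_congr_right (and_congr_right fun _ => and_congr_right fun _ =>
      forall_congr' fun y => forall_congr' fun _ => forall_congr' fun hy => ?_)
    rw [hB y hy]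
  · rw [ht.emptyOutside _ _ hc, ht'.emptyOutside _ _ hc]

theorem rowsWord_inj {a d : ℕ}
    (hlen : ∀ k, (rowWord lam t k).length = (rowWord lam t' k).length)
    (h : rowsWord lam t a d = rowsWord lam t' a d) :
    ∀ k, a ≤ k → k < a + d → rowWord lam t k = rowWord lam t' k := by
  induction d with
  | zero => intro k h1 h2; omega
  | succ d ih =>
    obtain ⟨h1, h2⟩ := List.append_inj h (hlen _)
    intro k hk hk'
    rcases (by omega : k = a + d ∨ k < a + d) with rfl | hlt
    · exact h1
    · exact ih h2 k hk hlt

/-- A set-valued tableau is determined by its reading word and the lengths of its row words. -/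
theorem IsSVT.eq_of_rowsWord (ht : IsSVT n lam t) (ht' : IsSVT n lam t')
    (hl : IsPartitionShape n lam)
    (hlen : ∀ k, (rowWord lam t k).length = (rowWord lam t' k).length)
    (h : rowsWord lam t 0 n = rowsWord lam t' 0 n) : t = t' := by
  funext r
  by_cases hr : r < n
  · exact ht.row_eq ht' (rowsWord_inj hlen h r (Nat.zero_le r) (by omega))
  · funext c
    have : ¬ c < lam r := by rw [hl.2 r (not_lt.1 hr)]; omega
    rw [ht.emptyOutside _ _ this, ht'.emptyOutside _ _ this]

end

theorem WordStep.sum {i : ℕ} {w w' : List ℕ} (h : WordStep i w w') : w'.sum = w.sum + 1 := by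
  obtain ⟨u, v, rfl, rfl, -⟩ := h
  simp only [List.sum_append, List.sum_cons]
  omega

section

variable {n : ℕ} {lam mu : ℕ → ℕ} {t t' t0 u0 : Filling} {r c i : ℕ}

theorem IsSVT.eRaw_eq_none_iff_wordEps (ht : IsSVT n lam t) (hl : IsPartitionShape n lam)
    (hi : 1 ≤ i) (hin : i < n) :
    eRaw n lam i t = none ↔ wordEps i (rowsWord lam t 0 n) = 0 := by
  refine ⟨ht.wordEps_eq_zero hl, fun h => ?_⟩
  rcases h' : eRaw n lam i t with _ | t'
  · rfl
  · have := (ht.tableauStep_eRaw hl hi hin h').wordStep.phi_eps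
    omega

theorem IsSVT.fRaw_eq_none_iff_wordPhi (ht : IsSVT n lam t) (hl : IsPartitionShape n lam)
    (hin : i < n) : fRaw n lam i t = none ↔ wordPhi i (rowsWord lam t 0 n) = 0 := by
  refine ⟨ht.wordPhi_eq_zero hl, fun h => ?_⟩
  rcases h' : fRaw n lam i t with _ | t'
  · rfl
  · have := (ht.tableauStep_fRaw hl hin h').wordStep.phi_eps
    omega

theorem IsSVT.isHighestWord (ht : IsSVT n lam t) (hl : IsPartitionShape n lam)
    (h : IsYamanouchi n lam t) : IsHighestWord (rowsWord lam t 0 n) := by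
  intro i hi
  by_cases hin : i < n
  · exact ht.wordEps_eq_zero hl (h i hi hin)
  · refine wordEps_eq_zero_of_notMem fun h' => ?_
    have := ht.bounds_of_mem_rowsWord h'
    omega

/-- The weight of a Yamanouchi tableau is a partition. -/
theorem IsSVT.isPartitionShape_wt (ht : IsSVT n lam t) (hl : IsPartitionShape n lam)
    (h : IsYamanouchi n lam t) : IsPartitionShape n fun r => wt n lam t (r + 1) := by
  constructor
  · intro r
    have h1 := wordPhi_add_count (r + 1) (rowsWord lam t 0 n)
    rw [ht.isHighestWord hl h (r + 1) (by omega), ht.count_rowsWord_eq_wt hl,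
      ht.count_rowsWord_eq_wt hl] at h1
    show wt n lam t (r + 1 + 1) ≤ wt n lam t (r + 1)
    omega
  · intro r hr
    show wt n lam t (r + 1) = 0
    rw [← ht.count_rowsWord_eq_wt hl]
    refine List.count_eq_zero_of_not_mem fun h' => ?_
    have := ht.bounds_of_mem_rowsWord h'
    omega

theorem IsSVT.isSSYT_iff_length (ht : IsSVT n lam t) :
    IsSSYT n lam t ↔ ∀ k, (rowWord lam t k).length = lam k := by
  have hlen : ∀ k, (rowWord lam t k).length = lam k ↔ rowExtra lam t k = ∅ := fun k => by
    rw [rowWord, List.length_append, List.length_map, List.length_range, Finset.length_sort,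
      ← Finset.card_eq_zero]
    omega
  simp only [hlen]
  constructor
  · intro h k
    refine Finset.eq_empty_of_forall_notMem fun a ha => ?_
    obtain ⟨c, hc, hac, hlt⟩ := mem_rowExtra.1 ha
    obtain ⟨b, hb⟩ := Finset.card_eq_one.1 (h.2 k c hc)
    have hm := ht.boxMin_mem' hc
    rw [hb, Finset.mem_singleton] at hac hm
    omega
  · refine fun h => ⟨ht, fun r c hc => Finset.card_eq_one.2 ⟨boxMin t r c, ?_⟩⟩
    refine Finset.eq_singleton_iff_unique_mem.2 ⟨ht.boxMin_mem' hc, fun a ha => ?_⟩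
    by_contra hne
    have : a ∈ rowExtra lam t r :=
      mem_rowExtra.2 ⟨c, hc, ha, lt_of_le_of_ne (boxMin_le ha) (Ne.symm hne)⟩
    simp [h r] at this

theorem mem_uTab {a : ℕ} : a ∈ uTab lam r c ↔ a = r + 1 ∧ c < lam r := by
  unfold uTab
  split_ifs with h <;> simp [h]

theorem isSSYT_uTab (hl : IsPartitionShape n lam) : IsSSYT n lam (uTab lam) := by
  refine ⟨⟨fun r c hc => ⟨r + 1, mem_uTab.2 ⟨rfl, hc⟩⟩, fun r c hc => if_neg hc,
    fun r c a ha => ?_, fun r c a b ha hb => ?_, fun r c a b ha hb => ?_⟩, fun r c hc => ?_⟩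
  · obtain ⟨rfl, h⟩ := mem_uTab.1 ha
    have : r < n := not_le.1 fun h' => by rw [hl.2 r h'] at h; omega
    omega
  · rw [mem_uTab] at ha hb
    omega
  · rw [mem_uTab] at ha hb
    omega
  · rw [uTab, if_pos hc, Finset.card_singleton]

theorem isYamanouchi_uTab (hl : IsPartitionShape n lam) : IsYamanouchi n lam (uTab lam) := by
  intro i hi hin
  refine eRaw_eq_none_iff.2 ?_
  rintro ⟨c, hc⟩
  obtain ⟨r, -, h⟩ := hc.colHas
  obtain ⟨h1, h2⟩ := mem_uTab.1 h
  obtain rfl : i = r := by omega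
  have := hl.antitone (Nat.sub_le i 1)
  exact hc.not_colHas ⟨i - 1, by omega, mem_uTab.2 (by omega)⟩

theorem count_rowsWord_uTab (hl : IsPartitionShape n lam) (a : ℕ) :
    (rowsWord lam (uTab lam) 0 n).count (a + 1) = lam a := by
  rw [(isSSYT_uTab hl).1.count_rowsWord, zero_add, ← Finset.range_eq_Ico]
  have h : ∀ k, rowCount (uTab lam) (a + 1) k (Finset.range (lam k)) =
      if a = k then lam a else 0 := fun k => by
    split_ifs with h
    · subst h
      rw [rowCount, Finset.filter_true_of_mem, Finset.card_range]
      exact fun y hy => mem_uTab.2 ⟨rfl, Finset.mem_range.1 hy⟩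
    · refine rowCount_eq_zero.2 fun y _ hy => h ?_
      have := (mem_uTab.1 hy).1
      omega
  simp only [h, Finset.sum_ite_eq, Finset.mem_range]
  split_ifs with h'
  · rfl
  · exact (hl.2 a (not_lt.1 h')).symm

/-- `uTab lam` is the only Yamanouchi semistandard tableau of shape `lam`. -/
theorem IsSSYT.eq_uTab (ht : IsSSYT n lam t) (hl : IsPartitionShape n lam)
    (hy : IsYamanouchi n lam t) : t = uTab lam := by
  have hw := ht.1.isHighestWord hl hy
  have key : ∀ r, r < n → ∀ c a, a ∈ t r c → a ≤ r + 1 := by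
    intro r
    induction r using Nat.strong_induction_on with
    | _ r ih =>
      intro hr c a ha
      by_contra hlt
      have hc := ht.1.col_lt ha
      have hm : lam r - 1 < lam r := by omega
      have hab : a ≤ boxMin t r (lam r - 1) := by
        rcases (by omega : c = lam r - 1 ∨ c < lam r - 1) with rfl | h
        · obtain ⟨b, hb⟩ := Finset.card_eq_one.1 (ht.2 r _ hm)
          have := ht.1.boxMin_mem' hm
          rw [hb, Finset.mem_singleton] at ha this
          omega
        · exact ht.1.le_boxMin ha h hm
      obtain ⟨i, hi⟩ : ∃ i, boxMin t r (lam r - 1) = i + 1 :=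
        ⟨boxMin t r (lam r - 1) - 1, by omega⟩
      rw [rowsWord_split hr, rowWord_eq_append_cons hm, hi,
        show lam r - (lam r - 1 + 1) = 0 by omega, List.range'_zero, List.map_nil,
        List.append_assoc _ [i + 1], ← List.append_assoc] at hw
      have h1 := hw.of_append i (by omega)
      have h2 := (word_append i [i + 1] (rowsWord lam t 0 r)).2
      rw [h1, wordPhi_eq_zero_of_notMem (w := rowsWord lam t 0 r)] at h2
      · simp [wordEps, wordPhi] at h2
      · intro h
        rw [← List.count_pos_iff, ht.1.count_rowsWord] at h
        obtain ⟨k, hk, hk'⟩ := Finset.exists_ne_zero_of_sum_ne_zero h.ne'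
        rw [Ne, rowCount_eq_zero] at hk'
        push Not at hk'
        obtain ⟨y, -, hy⟩ := hk'
        rw [Finset.mem_Ico] at hk
        have := ih k (by omega) (by omega) y i hy
        omega
  funext r c
  rw [uTab]
  split_ifs with hc
  · have hr : r < n := not_le.1 fun h => by rw [hl.2 r h] at hc; omega
    refine Finset.eq_singleton_iff_nonempty_unique_mem.2 ⟨ht.1.boxNonempty r c hc, fun a ha => ?_⟩
    have h1 := key r hr c a ha
    have h2 := (ht.1.entryBounds r c a ha).1
    rcases Nat.eq_zero_or_pos r with rfl | hpos
    · omega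
    · obtain ⟨b, hb⟩ := ht.1.boxNonempty 0 c (hc.trans_le (hl.antitone hpos.le))
      have h3 := (ht.1.entryBounds 0 c b hb).1
      have h4 := ht.1.col_add_le hl hpos hb ha
      omega
  · exact ht.1.emptyOutside r c hc

/-- Every semistandard tableau lies in the component of `uTab lam`. -/
theorem IsSSYT.reach_uTab (ht : IsSSYT n lam t) (hl : IsPartitionShape n lam) :
    Reach n lam (uTab lam) t := by
  induction h : (rowsWord lam t 0 n).sum generalizing t with
  | zero =>
    refine ht.eq_uTab hl (fun i hi hin => ?_) ▸ Reach.base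
    rcases h' : eRaw n lam i t with _ | t'
    · rfl
    · have := (ht.1.tableauStep_eRaw hl hi hin h').wordStep.sum
      omega
  | succ s ih =>
    by_cases hy : IsYamanouchi n lam t
    · exact ht.eq_uTab hl hy ▸ Reach.base
    · unfold IsYamanouchi at hy
      push Not at hy
      obtain ⟨i, hi, hin, h'⟩ := hy
      obtain ⟨t', ht'⟩ := Option.ne_none_iff_exists'.1 h'
      have hs := ht.1.tableauStep_eRaw hl hi hin ht'
      refine Reach.stepF i hi hin (ih ?_ ?_) hs.eq
      · exact hs.left.isSSYT_iff_length.2 fun k =>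
          (hs.length k).symm.trans (ht.1.isSSYT_iff_length.1 ht k)
      · have := hs.wordStep.sum
        omega

theorem Reach.isSVT_and_length (h : Reach n lam t0 t) (h0 : IsSVT n lam t0)
    (hl : IsPartitionShape n lam) :
    IsSVT n lam t ∧ ∀ k, (rowWord lam t k).length = (rowWord lam t0 k).length := by
  induction h with
  | base => exact ⟨h0, fun _ => rfl⟩
  | stepF i hi hin _ hf ih =>
    have hs := ih.1.tableauStep_fRaw hl hin hf
    exact ⟨hs.right, fun k => (hs.length k).trans (ih.2 k)⟩
  | stepE i hi hin _ he ih =>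
    have hs := ih.1.tableauStep_eRaw hl hi hin he
    exact ⟨hs.left, fun k => (hs.length k).symm.trans (ih.2 k)⟩

theorem Reach.eq_of_rowsWord (h : Reach n lam t0 t) (h' : Reach n lam t0 t')
    (h0 : IsSVT n lam t0) (hl : IsPartitionShape n lam)
    (hw : rowsWord lam t 0 n = rowsWord lam t' 0 n) : t = t' :=
  (h.isSVT_and_length h0 hl).1.eq_of_rowsWord (h'.isSVT_and_length h0 hl).1 hl
    (fun k => ((h.isSVT_and_length h0 hl).2 k).trans ((h'.isSVT_and_length h0 hl).2 k).symm) hw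

variable {m : ℕ} {R : List ℕ → List ℕ → Prop} {u : Filling}

theorem IsCrystalRel.exists_fRaw (hR : IsCrystalRel m R) (ht : IsSVT n lam t)
    (hl : IsPartitionShape n lam) (hu : IsSVT n mu u) (hm : IsPartitionShape n mu)
    (h : R (rowsWord lam t 0 n) (rowsWord mu u 0 n)) (hin : i < n)
    (hf : fRaw n lam i t = some t') :
    ∃ u', fRaw n mu i u = some u' ∧ R (rowsWord lam t' 0 n) (rowsWord mu u' 0 n) := by
  have hs := (ht.tableauStep_fRaw hl hin hf).wordStep
  rcases h' : fRaw n mu i u with _ | u'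
  · have h1 := (hu.fRaw_eq_none_iff_wordPhi hm hin).1 h'
    have h2 := hR.phi h i
    have h3 := hs.phi_eps
    omega
  · exact ⟨u', rfl, hR.step h hs (hu.tableauStep_fRaw hm hin h').wordStep⟩

theorem IsCrystalRel.exists_eRaw (hR : IsCrystalRel m R) (ht : IsSVT n lam t)
    (hl : IsPartitionShape n lam) (hu : IsSVT n mu u) (hm : IsPartitionShape n mu)
    (h : R (rowsWord lam t 0 n) (rowsWord mu u 0 n)) (hi : 1 ≤ i) (hin : i < n)
    (he : eRaw n lam i t = some t') :
    ∃ u', eRaw n mu i u = some u' ∧ R (rowsWord lam t' 0 n) (rowsWord mu u' 0 n) := by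
  have hs := (ht.tableauStep_eRaw hl hi hin he).wordStep
  rcases h' : eRaw n mu i u with _ | u'
  · have h1 := (hu.eRaw_eq_none_iff_wordEps hm hi hin).1 h'
    have h2 := hR.eps h i
    have h3 := hs.phi_eps
    omega
  · exact ⟨u', rfl, hR.step_left h hs (hu.tableauStep_eRaw hm hi hin h').wordStep⟩

theorem IsCrystalRel.exists_reach (hR : IsCrystalRel m R) (h0 : IsSVT n lam t0)
    (hl : IsPartitionShape n lam) (hu0 : IsSVT n mu u0) (hm : IsPartitionShape n mu)
    (h : R (rowsWord lam t0 0 n) (rowsWord mu u0 0 n)) (ht : Reach n lam t0 t) :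
    ∃ u, Reach n mu u0 u ∧ R (rowsWord lam t 0 n) (rowsWord mu u 0 n) := by
  induction ht with
  | base => exact ⟨u0, Reach.base, h⟩
  | stepF i hi hin hr hf ih =>
    obtain ⟨u, hu, hru⟩ := ih
    obtain ⟨u', h1, h2⟩ := hR.exists_fRaw (hr.isSVT_and_length h0 hl).1 hl
      (hu.isSVT_and_length hu0 hm).1 hm hru hin hf
    exact ⟨u', hu.stepF i hi hin h1, h2⟩
  | stepE i hi hin hr he ih =>
    obtain ⟨u, hu, hru⟩ := ih
    obtain ⟨u', h1, h2⟩ := hR.exists_eRaw (hr.isSVT_and_length h0 hl).1 hl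
      (hu.isSVT_and_length hu0 hm).1 hm hru hi hin he
    exact ⟨u', hu.stepE i hi hin h1, h2⟩

/-- Components of tableaux with crystal-equivalent reading words are isomorphic. -/
theorem IsCrystalRel.exists_componentIso (hR : IsCrystalRel m R) (h0 : IsSVT n lam t0)
    (hl : IsPartitionShape n lam) (hu0 : IsSVT n mu u0) (hm : IsPartitionShape n mu)
    (h : R (rowsWord lam t0 0 n) (rowsWord mu u0 0 n)) :
    ∃ φ : Filling → Filling,
      (∀ t, Reach n lam t0 t → Reach n mu u0 (φ t)) ∧
      (∀ t t', Reach n lam t0 t → Reach n lam t0 t' → φ t = φ t' → t = t') ∧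
      (∀ u, Reach n mu u0 u → ∃ t, Reach n lam t0 t ∧ φ t = u) ∧
      (∀ t, Reach n lam t0 t → ∀ j, wt n mu (φ t) j = wt n lam t j) ∧
      (∀ t, Reach n lam t0 t → ∀ i, 1 ≤ i → i < n →
        (eRaw n lam i t = none ↔ eRaw n mu i (φ t) = none) ∧
        (∀ t', eRaw n lam i t = some t' → eRaw n mu i (φ t) = some (φ t')) ∧
        (fRaw n lam i t = none ↔ fRaw n mu i (φ t) = none) ∧
        (∀ t', fRaw n lam i t = some t' → fRaw n mu i (φ t) = some (φ t'))) := by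
  have hex : ∀ t, ∃ u, Reach n lam t0 t →
      Reach n mu u0 u ∧ R (rowsWord lam t 0 n) (rowsWord mu u 0 n) := fun t => by
    by_cases ht : Reach n lam t0 t
    · obtain ⟨u, hu⟩ := hR.exists_reach h0 hl hu0 hm h ht
      exact ⟨u, fun _ => hu⟩
    · exact ⟨t, fun ht' => absurd ht' ht⟩
  choose φ hφ using hex
  have huniq : ∀ t u, Reach n lam t0 t → Reach n mu u0 u →
      R (rowsWord lam t 0 n) (rowsWord mu u 0 n) → u = φ t := fun t u ht hu hru =>
    hu.eq_of_rowsWord (hφ t ht).1 hu0 hm (hR.right_unique hru (hφ t ht).2)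
  have hsvt : ∀ t, Reach n lam t0 t → IsSVT n lam t := fun t ht =>
    (ht.isSVT_and_length h0 hl).1
  have hsvt' : ∀ t, Reach n lam t0 t → IsSVT n mu (φ t) := fun t ht =>
    ((hφ t ht).1.isSVT_and_length hu0 hm).1
  refine ⟨φ, fun t ht => (hφ t ht).1, fun t t' ht ht' he => ?_, fun u hu => ?_, fun t ht j => ?_,
    fun t ht i hi hin => ⟨?_, fun t' he => ?_, ?_, fun t' hf => ?_⟩⟩
  · have h1 := (hφ t ht).2
    rw [he] at h1
    exact ht.eq_of_rowsWord ht' h0 hl (hR.left_unique h1 (hφ t' ht').2)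
  · obtain ⟨t, ht, hru⟩ := hR.flip.exists_reach hu0 hm h0 hl h hu
    exact ⟨t, ht, (huniq t u ht hu hru).symm⟩
  · rw [← (hsvt t ht).count_rowsWord_eq_wt hl, ← (hsvt' t ht).count_rowsWord_eq_wt hm]
    exact ((hR.perm (hφ t ht).2).count_eq j).symm
  · rw [(hsvt t ht).eRaw_eq_none_iff_wordEps hl hi hin,
      (hsvt' t ht).eRaw_eq_none_iff_wordEps hm hi hin, hR.eps (hφ t ht).2]
  · obtain ⟨u', h1, h2⟩ :=
      hR.exists_eRaw (hsvt t ht) hl (hsvt' t ht) hm (hφ t ht).2 hi hin he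
    rw [h1, huniq t' u' (ht.stepE i hi hin he) ((hφ t ht).1.stepE i hi hin h1) h2]
  · rw [(hsvt t ht).fRaw_eq_none_iff_wordPhi hl hin,
      (hsvt' t ht).fRaw_eq_none_iff_wordPhi hm hin, hR.phi (hφ t ht).2]
  · obtain ⟨u', h1, h2⟩ := hR.exists_fRaw (hsvt t ht) hl (hsvt' t ht) hm (hφ t ht).2 hin hf
    rw [h1, huniq t' u' (ht.stepF i hi hin hf) ((hφ t ht).1.stepF i hi hin h1) h2]

end

/-- if `T ∈ SVT^n(λ)` is Yamanouchi with weight `μ`, then `μ` is a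
partition and the crystal closure of `T` is isomorphic to `SSYT^n(μ) = B(μ)`. -/
theorem yamanouchi_component_iso (n : ℕ) (lam : ℕ → ℕ) (hlam : IsPartitionShape n lam)
    (t0 : Filling) (ht0 : IsSVT n lam t0) (hyam : IsYamanouchi n lam t0) :
    IsPartitionShape n (fun r => wt n lam t0 (r + 1)) ∧
    ∃ φ : Filling → Filling,
      (∀ t, Reach n lam t0 t → IsSSYT n (fun r => wt n lam t0 (r + 1)) (φ t)) ∧
      (∀ t t', Reach n lam t0 t → Reach n lam t0 t' → φ t = φ t' → t = t') ∧
      (∀ u, IsSSYT n (fun r => wt n lam t0 (r + 1)) u →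
        ∃ t, Reach n lam t0 t ∧ φ t = u) ∧
      (∀ t, Reach n lam t0 t →
        ∀ j, wt n (fun r => wt n lam t0 (r + 1)) (φ t) j = wt n lam t j) ∧
      (∀ t, Reach n lam t0 t → ∀ i, 1 ≤ i → i < n →
        (eRaw n lam i t = none ↔ eRaw n (fun r => wt n lam t0 (r + 1)) i (φ t) = none) ∧
        (∀ t', eRaw n lam i t = some t' →
          eRaw n (fun r => wt n lam t0 (r + 1)) i (φ t) = some (φ t')) ∧
        (fRaw n lam i t = none ↔ fRaw n (fun r => wt n lam t0 (r + 1)) i (φ t) = none) ∧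
        (∀ t', fRaw n lam i t = some t' →
          fRaw n (fun r => wt n lam t0 (r + 1)) i (φ t) = some (φ t'))) := by
  have hm := ht0.isPartitionShape_wt hlam hyam
  set mu : ℕ → ℕ := fun r => wt n lam t0 (r + 1) with hmu
  have hu := isSSYT_uTab hm
  have hperm : (rowsWord lam t0 0 n).Perm (rowsWord mu (uTab mu) 0 n) := by
    refine List.perm_iff_count.2 fun a => ?_
    rcases a with _ | a
    · rw [List.count_eq_zero_of_not_mem fun h => Nat.not_lt_zero 0 (ht0.bounds_of_mem_rowsWord h).1,
        List.count_eq_zero_of_not_mem fun h => Nat.not_lt_zero 0 (hu.1.bounds_of_mem_rowsWord h).1]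
    · rw [ht0.count_rowsWord_eq_wt hlam, count_rowsWord_uTab hm]
  obtain ⟨k, R, hR, h⟩ := (ht0.isHighestWord hlam hyam).wordIso
    (hu.1.isHighestWord hm (isYamanouchi_uTab hm))
    (fun a ha => (ht0.bounds_of_mem_rowsWord ha).1) hperm
  obtain ⟨φ, h1, h2, h3, h4, h5⟩ := hR.exists_componentIso ht0 hlam hu.1 hm h
  refine ⟨hm, φ, fun t ht => ?_, h2, fun u hu' => h3 u (hu'.reach_uTab hm), h4, h5⟩
  obtain ⟨h6, h7⟩ := (h1 t ht).isSVT_and_length hu.1 hm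
  exact h6.isSSYT_iff_length.2 fun k => (h7 k).trans (hu.1.isSSYT_iff_length.1 hu k)

end SVTCrystal

end
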